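/- Let p ≥ 4 and c > 0. There exists a₀ > 0 (depending only on p and c) such that for every a with 0 < a < a₀, the coverage probability of the recentered set is nonincreasing in |θ|: whenever θ₁, θ₂ ∈ ℝ^p satisfy |θ₁| ≤ |θ₂|, P_{θ₁}({x : |θ₁ − δ⁺_a(x)| ≤ c}) ≥ P_{θ₂}({x : |θ₂ − δ⁺_a(x)| ≤ c}). -/

import Mathlib

open MeasureTheory ProbabilityTheory

/-- Euclidean norm on `Fin p → ℝ`. -/
noncomputable def euclNorm {p : ℕ} (x : Fin p → ℝ) : ℝ := Real.sqrt (∑ i, (x i) ^ 2)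

/-- Positive-part James–Stein estimator `δ⁺_a(x) = max(0, 1 - a/|x|²) • x`, with value `0` at `0`. -/
noncomputable def jsPlus {p : ℕ} (a : ℝ) (x : Fin p → ℝ) : Fin p → ℝ :=
  if x = 0 then 0 else (max 0 (1 - a / (euclNorm x) ^ 2)) • x

/-- The `p`-variate normal distribution `N(θ, I_p)`: the product measure whose `i`-th
coordinate is the one-dimensional Gaussian `N(θ i, 1)`. -/
noncomputable def gaussPi (p : ℕ) (θ : Fin p → ℝ) : Measure (Fin p → ℝ) :=
  Measure.pi fun i => gaussianReal (θ i) 1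

/-- clipped weight -/
noncomputable def Wt (n : ℕ) (v : ℝ) : ℝ := Real.sqrt (1 - v ^ 2) ^ n

lemma Wt_continuous (n : ℕ) : Continuous (Wt n) := by
  unfold Wt; fun_prop

lemma Wt_nonneg (n : ℕ) (v : ℝ) : 0 ≤ Wt n v := by unfold Wt; positivity

lemma Wt_zero (n : ℕ) {v : ℝ} (h : 1 ≤ v ^ 2) : Wt (n + 1) v = 0 := by
  unfold Wt; rw [Real.sqrt_eq_zero_of_nonpos (by linarith)]; simp

lemma Wt_succ (n : ℕ) (v : ℝ) : Wt (n + 3) v = (1 - v ^ 2) * Wt (n + 1) v := by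
  by_cases h : 1 ≤ v ^ 2
  · rw [Wt_zero n h, Wt_zero (n + 2) h]; simp
  · unfold Wt
    have : 0 ≤ 1 - v ^ 2 := by linarith
    have h2 := Real.sq_sqrt this
    calc _ = Real.sqrt (1 - v ^ 2) ^ 2 * Real.sqrt (1 - v ^ 2) ^ (n + 1) := by ring
      _ = _ := by rw [h2]

lemma sqrt_pow_hasDerivAt (n : ℕ) (u : ℝ) :
    HasDerivAt (fun u : ℝ => Real.sqrt u ^ (n + 3)) ((n + 3) / 2 * Real.sqrt u ^ (n + 1)) u := by
  have key : (fun u : ℝ => Real.sqrt u ^ (n + 3)) = fun u : ℝ => (max u 0) ^ (((n : ℝ) + 3) / 2) := by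
    funext u
    rcases le_total u 0 with h | h
    · rw [max_eq_right h, Real.sqrt_eq_zero_of_nonpos h, Real.zero_rpow (by positivity)]; simp
    · rw [max_eq_left h, Real.sqrt_eq_rpow, ← Real.rpow_natCast, ← Real.rpow_mul h]
      congr 1; push_cast; ring
  rcases lt_trichotomy u 0 with h | h | h
  · have : (fun u : ℝ => Real.sqrt u ^ (n + 3)) =ᶠ[nhds u] fun _ => 0 := by
      filter_upwards [gt_mem_nhds h] with y hy
      rw [Real.sqrt_eq_zero_of_nonpos hy.le]; simp
    rw [Real.sqrt_eq_zero_of_nonpos h.le]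
    simpa using (hasDerivAt_const u (0 : ℝ)).congr_of_eventuallyEq this
  · subst h
    have : (fun u : ℝ => Real.sqrt u ^ (n + 3)) = fun u => u * (Real.sqrt u ^ (n + 1)) := by
      funext u
      rcases le_total u 0 with h | h
      · rw [Real.sqrt_eq_zero_of_nonpos h]; simp
      · calc _ = Real.sqrt u ^ 2 * Real.sqrt u ^ (n + 1) := by ring
          _ = _ := by rw [Real.sq_sqrt h]
    rw [this, hasDerivAt_iff_tendsto_slope_zero]
    have hc : Continuous (fun u : ℝ => Real.sqrt u ^ (n + 1)) := by fun_prop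
    have h1 := (hc.tendsto 0).mono_left (nhdsWithin_le_nhds (s := {0}ᶜ))
    simp only [Real.sqrt_zero, zero_add, zero_mul, sub_zero, smul_eq_mul]
    simp only [Real.sqrt_zero] at h1
    have h2 : ((n : ℝ) + 3) / 2 * 0 ^ (n + 1) = 0 ^ (n + 1) := by simp
    rw [h2]
    refine h1.congr' ?_
    filter_upwards [self_mem_nhdsWithin] with t ht
    have : t ≠ 0 := ht
    field_simp
  · have := (Real.hasDerivAt_sqrt h.ne').pow (n + 3)
    refine this.congr_deriv ?_
    have h0 : Real.sqrt u ≠ 0 := (Real.sqrt_pos.2 h).ne'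
    push_cast
    field_simp
    try ring

lemma Wt_hasDerivAt (n : ℕ) (v : ℝ) :
    HasDerivAt (Wt (n + 3)) (-((n + 3) * v * Wt (n + 1) v)) v := by
  have h1 : HasDerivAt (fun v : ℝ => 1 - v ^ 2) (-(2 * v)) v := by
    simpa using ((hasDerivAt_id v).pow 2).const_sub 1
  have := (sqrt_pow_hasDerivAt n (1 - v ^ 2)).comp v h1
  refine this.congr_deriv ?_
  unfold Wt; ring

/-- moments of the weight -/
noncomputable def Phi (k m : ℕ) (x b : ℝ) : ℝ :=
  ∫ v in b..1, v ^ k * Wt (m + 1) v * Real.exp (x * v)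

lemma Phi_cont (k m : ℕ) : Continuous (fun z : ℝ × ℝ => Phi k m z.1 z.2) := by
  have : (fun z : ℝ × ℝ => Phi k m z.1 z.2) = fun z =>
      - ∫ v in (1 : ℝ)..z.2, v ^ k * Wt (m + 1) v * Real.exp (z.1 * v) := by
    funext z; unfold Phi; rw [intervalIntegral.integral_symm]
  rw [this]
  have hW := Wt_continuous (m + 1)
  refine Continuous.neg ?_
  refine intervalIntegral.continuous_parametric_intervalIntegral_of_continuous
    (f := fun z : ℝ × ℝ => fun v => v ^ k * Wt (m + 1) v * Real.exp (z.1 * v)) ?_ continuous_snd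
  unfold Function.uncurry
  fun_prop

lemma Phi_deriv_b (k m : ℕ) (x b : ℝ) :
    HasDerivAt (fun b => Phi k m x b) (-(b ^ k * Wt (m + 1) b * Real.exp (x * b))) b := by
  have hW := Wt_continuous (m + 1)
  have hc : Continuous (fun v : ℝ => v ^ k * Wt (m + 1) v * Real.exp (x * v)) := by fun_prop
  exact intervalIntegral.integral_hasDerivAt_left (hc.intervalIntegrable _ _)
    (hc.stronglyMeasurableAtFilter _ _) hc.continuousAt

lemma Phi_deriv_x (k m : ℕ) (x b : ℝ) :
    HasDerivAt (fun x => Phi k m x b) (Phi (k + 1) m x b) x := by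
  have hW := Wt_continuous (m + 1)
  have hc : ∀ k x, Continuous (fun v : ℝ => v ^ k * Wt (m + 1) v * Real.exp (x * v)) := by
    intros; fun_prop
  have := (intervalIntegral.hasDerivAt_integral_of_dominated_loc_of_deriv_le (μ := volume)
    (F := fun x v => v ^ k * Wt (m + 1) v * Real.exp (x * v))
    (F' := fun x v => v ^ (k + 1) * Wt (m + 1) v * Real.exp (x * v)) (x₀ := x) (a := b) (b := 1)
    (bound := fun v => |v ^ (k + 1) * Wt (m + 1) v| * Real.exp ((|x| + 1) * |v|))
    (Metric.ball_mem_nhds x one_pos) ?_ ?_ ?_ ?_ ?_ ?_).2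
  · exact this
  · exact Filter.Eventually.of_forall fun y => (hc k y).aestronglyMeasurable
  · exact (hc k x).intervalIntegrable _ _
  · exact (hc (k + 1) x).aestronglyMeasurable
  · refine Filter.Eventually.of_forall fun v _ y hy => ?_
    rw [norm_mul, Real.norm_eq_abs, Real.norm_eq_abs, Real.abs_exp]
    refine mul_le_mul_of_nonneg_left (Real.exp_le_exp.2 ?_) (abs_nonneg _)
    refine (le_abs_self _).trans ?_
    rw [abs_mul]
    refine mul_le_mul_of_nonneg_right ?_ (abs_nonneg _)
    rw [Metric.mem_ball, Real.dist_eq] at hy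
    have := abs_sub_abs_le_abs_sub y x
    linarith
  · refine Continuous.intervalIntegrable ?_ _ _
    fun_prop
  · refine Filter.Eventually.of_forall fun v _ y hy => ?_
    have h1 : HasDerivAt (fun y : ℝ => y * v) v y := by simpa using (hasDerivAt_id y).mul_const v
    refine ((h1.exp).const_mul _).congr_deriv ?_
    ring

lemma Phi_curve (k m : ℕ) {x b : ℝ → ℝ} {x' b' s : ℝ} (hx : HasDerivAt x x' s)
    (hb : HasDerivAt b b' s) :
    HasDerivAt (fun s => Phi k m (x s) (b s))
      (x' * Phi (k + 1) m (x s) (b s) - b' * (b s ^ k * Wt (m + 1) (b s) * Real.exp (x s * b s))) s := by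
  have hW := Wt_continuous (m + 1)
  have h := hasStrictFDerivAt_uncurry_coprod (𝕜 := ℝ) (u := (x s, b s)) (f := Phi k m)
    (f₁ := fun x b => ContinuousLinearMap.toSpanSingleton ℝ (Phi (k + 1) m x b))
    (f₂ := fun x b => ContinuousLinearMap.toSpanSingleton ℝ
      (-(b ^ k * Wt (m + 1) b * Real.exp (x * b))))
    (Filter.Eventually.of_forall fun v => (Phi_deriv_x k m v.1 v.2).hasFDerivAt)
    (Filter.Eventually.of_forall fun v => (Phi_deriv_b k m v.1 v.2).hasFDerivAt)
    (by
      have := Phi_cont (k + 1) m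
      have h2 : Continuous (fun z : ℝ × ℝ => ContinuousLinearMap.toSpanSingleton ℝ (Phi (k + 1) m z.1 z.2)) :=
        (ContinuousLinearMap.toSpanSingletonCLE (𝕜 := ℝ)).continuous.comp this
      exact h2.continuousAt)
    (by
      have : Continuous (fun z : ℝ × ℝ => (-(z.2 ^ k * Wt (m + 1) z.2 * Real.exp (z.1 * z.2)))) := by
        fun_prop
      have h2 : Continuous (fun z : ℝ × ℝ => ContinuousLinearMap.toSpanSingleton ℝ
        (-(z.2 ^ k * Wt (m + 1) z.2 * Real.exp (z.1 * z.2)))) :=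
        (ContinuousLinearMap.toSpanSingletonCLE (𝕜 := ℝ)).continuous.comp this
      exact h2.continuousAt)
  have h2 := h.hasFDerivAt.comp_hasDerivAt s (hx.prodMk hb)
  refine h2.congr_deriv ?_
  simp [Function.HasUncurry.uncurry]
  ring

lemma Phi_ibp (m : ℕ) (x b : ℝ) :
    x * (Phi 0 m x b - Phi 2 m x b) - (m + 3) * Phi 1 m x b
      = -(Wt (m + 3) b * Real.exp (x * b)) := by
  have hW := Wt_continuous (m + 1)
  have hc : ∀ k, Continuous (fun v : ℝ => v ^ k * Wt (m + 1) v * Real.exp (x * v)) := by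
    intros; fun_prop
  have hi : ∀ k, IntervalIntegrable (fun v : ℝ => v ^ k * Wt (m + 1) v * Real.exp (x * v)) volume b 1 :=
    fun k => (hc k).intervalIntegrable _ _
  have := intervalIntegral.integral_eq_sub_of_hasDerivAt (a := b) (b := 1)
    (f := fun v => Wt (m + 3) v * Real.exp (x * v))
    (f' := fun v => x * (v ^ 0 * Wt (m + 1) v * Real.exp (x * v) - v ^ 2 * Wt (m + 1) v * Real.exp (x * v))
       - (m + 3) * (v ^ 1 * Wt (m + 1) v * Real.exp (x * v))) ?_ ?_
  · rw [intervalIntegral.integral_sub ((((hi 0).sub (hi 2))).const_mul _) ((hi 1).const_mul _),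
      intervalIntegral.integral_const_mul, intervalIntegral.integral_sub (hi 0) (hi 2),
      intervalIntegral.integral_const_mul] at this
    unfold Phi
    rw [this, Wt_zero (m + 2) (by norm_num)]
    simp
  · intro v _
    have h1 : HasDerivAt (fun y : ℝ => x * y) x v := by simpa using (hasDerivAt_id v).const_mul x
    refine ((Wt_hasDerivAt m v).mul h1.exp).congr_deriv ?_
    rw [Wt_succ]; ring
  · exact ((((hi 0).sub (hi 2))).const_mul _).sub ((hi 1).const_mul _)

lemma Phi_clip (k m : ℕ) (x : ℝ) {b b' : ℝ} (h : ∀ v ∈ Set.uIcc b b', 1 ≤ v ^ 2) :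
    Phi k m x b = Phi k m x b' := by
  have hW := Wt_continuous (m + 1)
  have hc : Continuous (fun v : ℝ => v ^ k * Wt (m + 1) v * Real.exp (x * v)) := by fun_prop
  unfold Phi
  rw [← intervalIntegral.integral_add_adjacent_intervals (b := b') (hc.intervalIntegrable _ _) (hc.intervalIntegrable _ _)]
  have : ∫ v in b..b', v ^ k * Wt (m + 1) v * Real.exp (x * v) = ∫ v in b..b', (0 : ℝ) := by
    refine intervalIntegral.integral_congr fun v hv => ?_
    simp [Wt_zero m (h v hv)]
  rw [this]; simp

lemma div_alg (r a t b M c2 : ℝ) (hr : 0 < r) (ha : 0 < a) (hra : a < r ^ 2) (ht : 0 < t) (hM : 0 < M)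
    (hc : c2 = ((r ^ 2 - a) / r) ^ 2 + t ^ 2 - 2 * ((r ^ 2 - a) / r) * t * b) :
    (1 - b ^ 2) - r * (1 / ((r ^ 2 - a) / r) - b / t)
      - r * b * ((1 / t - b / ((r ^ 2 - a) / r)) * (1 + a / r ^ 2))
      - (a / M) * ((M / (r ^ 2 + a) - 2 * r ^ 2 / (r ^ 2 + a) ^ 2
          + r * (-r + t * b + r * t * ((1 / t - b / ((r ^ 2 - a) / r)) * (1 + a / r ^ 2)))
            / (r ^ 2 + a)) * (1 - b ^ 2)
        - M * r * b * ((1 / t - b / ((r ^ 2 - a) / r)) * (1 + a / r ^ 2)) / (r ^ 2 + a))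
      = -((a / M) * (2 * r ^ 2 / (r ^ 2 + a)) * (1 - b ^ 2) *
          (M / (r ^ 2 - a) - 1 / (r ^ 2 + a) - a * (t ^ 2 - c2) / (2 * (r ^ 2 - a) ^ 2))) := by
  subst hc
  have h1 : r ^ 2 - a ≠ 0 := by linarith
  have h2 : r ^ 2 + a ≠ 0 := by positivity
  field_simp
  ring

/-- A one-sided Green formula on a rectangle. -/
lemma green {F H dF dH : ℝ → ℝ → ℝ} {t₁ t₂ r₀ R : ℝ} (ht : t₁ ≤ t₂) (hR : r₀ ≤ R)
    (hcF : ContinuousOn (Function.uncurry dF) (Set.Icc t₁ t₂ ×ˢ Set.Icc r₀ R))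
    (hcH : ContinuousOn (Function.uncurry dH) (Set.Icc t₁ t₂ ×ˢ Set.Icc r₀ R))
    (hF : ∀ t ∈ Set.Icc t₁ t₂, ∀ r ∈ Set.Icc r₀ R, HasDerivAt (fun t => F t r) (dF t r) t)
    (hH : ∀ t ∈ Set.Icc t₁ t₂, ∀ r ∈ Set.Icc r₀ R, HasDerivAt (fun r => H t r) (dH t r) r)
    (hF1 : ∀ t ∈ Set.Icc t₁ t₂, ContinuousOn (F t) (Set.Icc r₀ R))
    (hH0 : ContinuousOn (fun t => H t r₀) (Set.Icc t₁ t₂))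
    (hH1 : ContinuousOn (fun t => H t R) (Set.Icc t₁ t₂))
    (hle : ∀ t ∈ Set.Icc t₁ t₂, ∀ r ∈ Set.Icc r₀ R, dF t r + dH t r ≤ 0) :
    (∫ r in r₀..R, F t₂ r) - (∫ r in r₀..R, F t₁ r)
      ≤ (∫ t in t₁..t₂, H t r₀) - ∫ t in t₁..t₂, H t R := by
  have hsec1 : ∀ {G : ℝ → ℝ → ℝ}, ContinuousOn (Function.uncurry G) (Set.Icc t₁ t₂ ×ˢ Set.Icc r₀ R) →
      ∀ t ∈ Set.Icc t₁ t₂, ContinuousOn (fun r => G t r) (Set.Icc r₀ R) := by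
    intro G hG t ht
    exact hG.comp (f := fun r => (t, r)) (by fun_prop) (fun r hr => ⟨ht, hr⟩)
  have hsec2 : ∀ {G : ℝ → ℝ → ℝ}, ContinuousOn (Function.uncurry G) (Set.Icc t₁ t₂ ×ˢ Set.Icc r₀ R) →
      ∀ r ∈ Set.Icc r₀ R, ContinuousOn (fun t => G t r) (Set.Icc t₁ t₂) := by
    intro G hG r hr
    exact hG.comp (f := fun t => (t, r)) (by fun_prop) (fun t ht => ⟨ht, hr⟩)
  have e1 : (∫ r in r₀..R, F t₂ r) - (∫ r in r₀..R, F t₁ r) = ∫ r in r₀..R, ∫ t in t₁..t₂, dF t r := by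
    rw [← intervalIntegral.integral_sub]
    · refine intervalIntegral.integral_congr fun r hr => ?_
      rw [Set.uIcc_of_le hR] at hr
      rw [intervalIntegral.integral_eq_sub_of_hasDerivAt (f := fun t => F t r)]
      · intro t h; rw [Set.uIcc_of_le ht] at h; exact hF t h r hr
      · refine ContinuousOn.intervalIntegrable ?_
        rw [Set.uIcc_of_le ht]; exact hsec2 hcF r hr
    · refine ContinuousOn.intervalIntegrable ?_
      rw [Set.uIcc_of_le hR]; exact hF1 _ ⟨ht, le_rfl⟩
    · refine ContinuousOn.intervalIntegrable ?_
      rw [Set.uIcc_of_le hR]; exact hF1 _ ⟨le_rfl, ht⟩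
  have hIn : IntegrableOn (Function.uncurry dF) (Set.Icc t₁ t₂ ×ˢ Set.Icc r₀ R) :=
    hcF.integrableOn_compact (isCompact_Icc.prod isCompact_Icc)
  have hint2 : IntegrableOn (Function.uncurry dH) (Set.Icc t₁ t₂ ×ˢ Set.Icc r₀ R) :=
    hcH.integrableOn_compact (isCompact_Icc.prod isCompact_Icc)
  have e2 : ∫ r in r₀..R, ∫ t in t₁..t₂, dF t r = ∫ t in t₁..t₂, ∫ r in r₀..R, dF t r := by
    simp only [intervalIntegral.integral_of_le ht, intervalIntegral.integral_of_le hR,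
      ← integral_Icc_eq_integral_Ioc]
    rw [integral_integral_swap]
    have := hIn
    rw [IntegrableOn, Measure.volume_eq_prod, ← Measure.prod_restrict] at this
    exact this.swap
  have e3 : (∫ t in t₁..t₂, H t r₀) - (∫ t in t₁..t₂, H t R) = ∫ t in t₁..t₂, ∫ r in r₀..R, - dH t r := by
    rw [← intervalIntegral.integral_sub]
    · refine intervalIntegral.integral_congr fun t h => ?_
      rw [Set.uIcc_of_le ht] at h
      rw [intervalIntegral.integral_neg, intervalIntegral.integral_eq_sub_of_hasDerivAt (f := fun r => H t r)]
      · ring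
      · intro r hr; rw [Set.uIcc_of_le hR] at hr; exact hH t h r hr
      · refine ContinuousOn.intervalIntegrable ?_
        rw [Set.uIcc_of_le hR]; exact hsec1 hcH t h
    · refine ContinuousOn.intervalIntegrable ?_
      rwa [Set.uIcc_of_le ht]
    · refine ContinuousOn.intervalIntegrable ?_
      rwa [Set.uIcc_of_le ht]
  rw [e1, e2, e3]
  have hIn' : Integrable (Function.uncurry dF) ((volume.restrict (Set.Icc t₁ t₂)).prod (volume.restrict (Set.Icc r₀ R))) := by
    have := hIn
    rwa [IntegrableOn, Measure.volume_eq_prod, ← Measure.prod_restrict] at this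
  have hint2' : Integrable (Function.uncurry dH) ((volume.restrict (Set.Icc t₁ t₂)).prod (volume.restrict (Set.Icc r₀ R))) := by
    have := hint2
    rwa [IntegrableOn, Measure.volume_eq_prod, ← Measure.prod_restrict] at this
  simp only [intervalIntegral.integral_of_le ht, intervalIntegral.integral_of_le hR,
      ← integral_Icc_eq_integral_Ioc]
  refine setIntegral_mono_on hIn'.integral_prod_left ?_ measurableSet_Icc fun t h => ?_
  · exact hint2'.neg.integral_prod_left
  · refine setIntegral_mono_on ?_ ?_ measurableSet_Icc fun r hr => ?_
    · exact (hsec1 hcF t h).integrableOn_compact isCompact_Icc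
    · exact (hsec1 hcH t h).neg.integrableOn_compact isCompact_Icc
    · linarith [hle t h r hr]

noncomputable def Ffun (m : ℕ) (t r b : ℝ) : ℝ :=
  r ^ (m + 3) * Real.exp (-(r ^ 2 + t ^ 2) / 2) * Phi 0 m (r * t) b

noncomputable def Hfun (m : ℕ) (t r b : ℝ) : ℝ :=
  r ^ (m + 3) * Real.exp (-(r ^ 2 + t ^ 2) / 2) * Phi 1 m (r * t) b

noncomputable def Cfun (m : ℕ) (a t r b : ℝ) : ℝ :=
  a / (m + 3) * (r ^ (m + 3) / (r ^ 2 + a)) * Real.exp (-(r ^ 2 + t ^ 2) / 2)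
    * (Real.exp (r * t * b) * Wt (m + 3) b)

noncomputable def dFfun (m : ℕ) (t r b bt : ℝ) : ℝ :=
  r ^ (m + 3) * Real.exp (-(r ^ 2 + t ^ 2) / 2) *
    (-t * Phi 0 m (r * t) b + r * Phi 1 m (r * t) b - bt * (Wt (m + 1) b * Real.exp (r * t * b)))

noncomputable def dHfun (m : ℕ) (t r b br : ℝ) : ℝ :=
  r ^ (m + 2) * Real.exp (-(r ^ 2 + t ^ 2) / 2) *
    (((m + 3) - r ^ 2) * Phi 1 m (r * t) b + r * t * Phi 2 m (r * t) b
      - r * br * (b * Wt (m + 1) b * Real.exp (r * t * b)))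

noncomputable def dCfun (m : ℕ) (a t r b br : ℝ) : ℝ :=
  r ^ (m + 2) * Real.exp (-(r ^ 2 + t ^ 2) / 2) * (Wt (m + 1) b * Real.exp (r * t * b)) *
    ((a / (m + 3)) * ((((m + 3) / (r ^ 2 + a) - 2 * r ^ 2 / (r ^ 2 + a) ^ 2
          + r * (-r + t * b + r * t * br) / (r ^ 2 + a)) * (1 - b ^ 2)
        - (m + 3) * r * b * br / (r ^ 2 + a))))

lemma Ffun_deriv (m : ℕ) {b : ℝ → ℝ} {t r bt : ℝ} (hb : HasDerivAt b bt t) :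
    HasDerivAt (fun t => Ffun m t r (b t)) (dFfun m t r (b t) bt) t := by
  have h1 : HasDerivAt (fun t : ℝ => r * t) r t := by simpa using (hasDerivAt_id t).const_mul r
  have h2 : HasDerivAt (fun t : ℝ => -(r ^ 2 + t ^ 2) / 2) (-t) t := by
    refine (((((hasDerivAt_id t).pow 2).const_add (r ^ 2)).neg).div_const 2).congr_deriv ?_
    simp
    ring
  refine ((h2.exp.const_mul (r ^ (m + 3))).mul (Phi_curve 0 m h1 hb)).congr_deriv ?_
  unfold dFfun; simp only [pow_zero, one_mul, zero_add]; ring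

lemma exp_r_deriv (t r : ℝ) : HasDerivAt (fun r : ℝ => Real.exp (-(r ^ 2 + t ^ 2) / 2))
    (Real.exp (-(r ^ 2 + t ^ 2) / 2) * (-r)) r := by
  have h2 : HasDerivAt (fun r : ℝ => -(r ^ 2 + t ^ 2) / 2) (-r) r := by
    refine (((((hasDerivAt_id r).pow 2).add_const (t ^ 2)).neg).div_const 2).congr_deriv ?_
    simp
    ring
  exact h2.exp

lemma pow_r_deriv (m : ℕ) (r : ℝ) : HasDerivAt (fun r : ℝ => r ^ (m + 3))
    ((m + 3) * r ^ (m + 2)) r := by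
  refine (hasDerivAt_pow (m + 3) r).congr_deriv ?_
  push_cast; rfl

lemma Hfun_deriv (m : ℕ) {b : ℝ → ℝ} {t r br : ℝ} (hb : HasDerivAt b br r) :
    HasDerivAt (fun r => Hfun m t r (b r)) (dHfun m t r (b r) br) r := by
  have h1 : HasDerivAt (fun r : ℝ => r * t) t r := by simpa using (hasDerivAt_id r).mul_const t
  refine (((pow_r_deriv m r).mul (exp_r_deriv t r)).mul (Phi_curve 1 m h1 hb)).congr_deriv ?_
  unfold dHfun; simp only [pow_one, Nat.reduceAdd, Pi.mul_apply]; ring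

lemma Cfun_deriv (m : ℕ) {b : ℝ → ℝ} {a t r br : ℝ} (ha : 0 < a) (hb : HasDerivAt b br r) :
    HasDerivAt (fun r => Cfun m a t r (b r)) (dCfun m a t r (b r) br) r := by
  have h1 : HasDerivAt (fun r : ℝ => r * t) t r := by simpa using (hasDerivAt_id r).mul_const t
  have h3 : HasDerivAt (fun r : ℝ => r ^ 2 + a) (2 * r) r := by
    simpa using ((hasDerivAt_id r).pow 2).add_const a
  have h0 : r ^ 2 + a ≠ 0 := by positivity
  refine (((((pow_r_deriv m r).div h3 h0).const_mul (a / ((m : ℝ) + 3))).mul (exp_r_deriv t r)).mul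
    ((h1.mul hb).exp.mul ((Wt_hasDerivAt m (b r)).comp r hb))).congr_deriv ?_
  have hm : (m : ℝ) + 3 ≠ 0 := by positivity
  unfold dCfun; simp only [Pi.mul_apply, Pi.div_apply, Function.comp]; rw [Wt_succ]
  field_simp
  ring

lemma div_full (m : ℕ) (t r b bt br : ℝ) :
    dFfun m t r b bt + dHfun m t r b br =
      r ^ (m + 2) * Real.exp (-(r ^ 2 + t ^ 2) / 2) * (Wt (m + 1) b * Real.exp (r * t * b)) *
        ((1 - b ^ 2) - r * bt - r * b * br) := by
  have h := Phi_ibp m (r * t) b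
  rw [Wt_succ] at h
  unfold dFfun dHfun
  linear_combination (-(r ^ (m + 2) * Real.exp (-(r ^ 2 + t ^ 2) / 2))) * h

noncomputable def sfun (a r : ℝ) : ℝ := (r ^ 2 - a) / r

noncomputable def v0 (a c t r : ℝ) : ℝ := (sfun a r ^ 2 + t ^ 2 - c ^ 2) / (2 * sfun a r * t)

lemma v0_deriv_t {a c t r : ℝ} (hs : sfun a r ≠ 0) (ht : t ≠ 0) :
    HasDerivAt (fun t => v0 a c t r) (1 / sfun a r - v0 a c t r / t) t := by
  have h1 : HasDerivAt (fun t : ℝ => sfun a r ^ 2 + t ^ 2 - c ^ 2) (2 * t) t := by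
    simpa using (((hasDerivAt_id t).pow 2).const_add (sfun a r ^ 2)).sub_const (c ^ 2)
  have h2 : HasDerivAt (fun t : ℝ => 2 * sfun a r * t) (2 * sfun a r) t := by
    simpa using (hasDerivAt_id t).const_mul (2 * sfun a r)
  refine (h1.div h2 (by positivity)).congr_deriv ?_
  unfold v0
  field_simp

lemma sfun_deriv {a r : ℝ} (hr : r ≠ 0) : HasDerivAt (sfun a) (1 + a / r ^ 2) r := by
  have h1 : HasDerivAt (fun r : ℝ => r ^ 2 - a) (2 * r) r := by
    simpa using ((hasDerivAt_id r).pow 2).sub_const a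
  refine (h1.div (hasDerivAt_id r) hr).congr_deriv ?_
  simp only [id]
  field_simp
  ring

lemma v0_deriv_r {a c t r : ℝ} (hr : r ≠ 0) (hs : sfun a r ≠ 0) (ht : t ≠ 0) :
    HasDerivAt (fun r => v0 a c t r) ((1 / t - v0 a c t r / sfun a r) * (1 + a / r ^ 2)) r := by
  have h0 := sfun_deriv (a := a) hr
  have h1 : HasDerivAt (fun r : ℝ => sfun a r ^ 2 + t ^ 2 - c ^ 2) (2 * sfun a r * (1 + a / r ^ 2)) r := by
    simpa using ((h0.pow 2).add_const (t ^ 2)).sub_const (c ^ 2)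
  have h2 : HasDerivAt (fun r : ℝ => 2 * sfun a r * t) (2 * (1 + a / r ^ 2) * t) r := by
    simpa using (h0.const_mul 2).mul_const t
  refine (h1.div h2 (by positivity)).congr_deriv ?_
  unfold v0
  field_simp

lemma bracket_nonneg {a c t r M : ℝ} (ha : 0 < a) (hr : 0 < r) (hra : a < r ^ 2) (ht : 0 < t) (hc : 0 < c)
    (hM : 3 ≤ M) (hb : v0 a c t r < 1) (hcond : t ≤ c ∨ (a ≤ 1 ∧ a * c ^ 2 ≤ 1)) :
    0 ≤ M / (r ^ 2 - a) - 1 / (r ^ 2 + a) - a * (t ^ 2 - c ^ 2) / (2 * (r ^ 2 - a) ^ 2) := by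
  have hq : 0 < r ^ 2 - a := by linarith
  have hs : 0 < sfun a r := div_pos hq hr
  have hsr : sfun a r * r = r ^ 2 - a := by unfold sfun; field_simp
  have h1 : 1 / (r ^ 2 + a) ≤ 1 / (r ^ 2 - a) := one_div_le_one_div_of_le hq (by linarith)
  have h2 : 3 / (r ^ 2 - a) ≤ M / (r ^ 2 - a) := div_le_div_of_nonneg_right hM hq.le
  have h3 : 3 / (r ^ 2 - a) = 2 / (r ^ 2 - a) + 1 / (r ^ 2 - a) := by ring
  have h5 : 0 < 2 / (r ^ 2 - a) := by positivity
  by_cases htc : t ≤ c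
  · have h4 : a * (t ^ 2 - c ^ 2) / (2 * (r ^ 2 - a) ^ 2) ≤ 0 := by
      refine div_nonpos_of_nonpos_of_nonneg ?_ (by positivity)
      have : t ^ 2 ≤ c ^ 2 := by gcongr
      nlinarith
    linarith
  · obtain ⟨ha1, hac⟩ := hcond.resolve_left htc
    push Not at htc
    unfold v0 at hb
    rw [div_lt_one (by positivity)] at hb
    have h6 : t - c < sfun a r := by nlinarith
    have h7 : sfun a r < r := by
      unfold sfun; rw [div_lt_iff₀ hr]; nlinarith
    have h8 : a * (t + c) ≤ 4 * r := by
      by_cases h : t ≤ 2 * c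
      · have : a * (t + c) ≤ a * (3 * c) := by gcongr; linarith
        have h9 : a * (3 * c) ≤ 4 * r := by
          refine abs_le_of_sq_le_sq' ?_ (by positivity) |>.2
          nlinarith
        linarith
      · nlinarith
    have h9 : a * (t ^ 2 - c ^ 2) ≤ 4 * (r ^ 2 - a) := by
      have : a * (t ^ 2 - c ^ 2) = (a * (t + c)) * (t - c) := by ring
      rw [this, ← hsr]
      have : (a * (t + c)) * (t - c) ≤ 4 * r * (t - c) := by
        apply mul_le_mul_of_nonneg_right h8; linarith
      nlinarith
    have h10 : a * (t ^ 2 - c ^ 2) / (2 * (r ^ 2 - a) ^ 2) ≤ 2 / (r ^ 2 - a) := by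
      rw [div_le_div_iff₀ (by positivity) hq]
      nlinarith
    linarith

lemma div_outer (m : ℕ) {a c t r : ℝ} (ha : 0 < a) (hr : 0 < r) (hra : a < r ^ 2) (ht : 0 < t) (hc : 0 < c)
    (hcond : t ≤ c ∨ (a ≤ 1 ∧ a * c ^ 2 ≤ 1)) :
    dFfun m t r (v0 a c t r) (1 / sfun a r - v0 a c t r / t)
      + (dHfun m t r (v0 a c t r) ((1 / t - v0 a c t r / sfun a r) * (1 + a / r ^ 2))
      - dCfun m a t r (v0 a c t r) ((1 / t - v0 a c t r / sfun a r) * (1 + a / r ^ 2))) ≤ 0 := by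
  have hq : 0 < r ^ 2 - a := by linarith
  have hs : 0 < sfun a r := div_pos hq hr
  have hb0 : c ^ 2 = ((r ^ 2 - a) / r) ^ 2 + t ^ 2 - 2 * ((r ^ 2 - a) / r) * t * v0 a c t r := by
    change c ^ 2 = sfun a r ^ 2 + t ^ 2 - 2 * sfun a r * t * v0 a c t r
    unfold v0; field_simp; ring
  have halg := div_alg r a t (v0 a c t r) (m + 3) (c ^ 2) hr ha hra ht (by positivity) hb0
  rw [← add_sub_assoc, div_full]
  unfold dCfun
  set b := v0 a c t r with hb
  have key : r ^ (m + 2) * Real.exp (-(r ^ 2 + t ^ 2) / 2) * (Wt (m + 1) b * Real.exp (r * t * b)) *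
      (-((a / (m + 3)) * (2 * r ^ 2 / (r ^ 2 + a)) * (1 - b ^ 2) *
          ((m + 3) / (r ^ 2 - a) - 1 / (r ^ 2 + a) - a * (t ^ 2 - c ^ 2) / (2 * (r ^ 2 - a) ^ 2)))) ≤ 0 := by
    by_cases h1 : 1 ≤ b ^ 2
    · rw [Wt_zero m h1]; simp
    · have hb1 : b < 1 := by nlinarith
      have h2 := bracket_nonneg (M := m + 3) ha hr hra ht hc (by linarith [(Nat.cast_nonneg m : (0 : ℝ) ≤ m)]) (hb ▸ hb1) hcond
      have h3 : 0 ≤ 1 - b ^ 2 := by linarith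
      have h4 := Wt_nonneg (m + 1) b
      refine mul_nonpos_of_nonneg_of_nonpos (by positivity) ?_
      rw [neg_nonpos]
      positivity
  rw [← halg] at key
  refine le_of_eq_of_le ?_ key
  unfold sfun
  ring

lemma mono_outer (m : ℕ) {a c t₁ t₂ r₀ R : ℝ} (ha : 0 < a) (hc : 0 < c) (hr : 0 < r₀) (hra : a < r₀ ^ 2)
    (hR : r₀ ≤ R) (ht0 : 0 < t₁) (ht : t₁ ≤ t₂) (hcond : t₂ ≤ c ∨ (a ≤ 1 ∧ a * c ^ 2 ≤ 1)) :
    (∫ r in r₀..R, Ffun m t₂ r (v0 a c t₂ r)) - (∫ r in r₀..R, Ffun m t₁ r (v0 a c t₁ r))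
      ≤ (∫ t in t₁..t₂, (Hfun m t r₀ (v0 a c t r₀) - Cfun m a t r₀ (v0 a c t r₀)))
        - ∫ t in t₁..t₂, (Hfun m t R (v0 a c t R) - Cfun m a t R (v0 a c t R)) := by
  have hR0 : 0 < R := hr.trans_le hR
  have hrr : ∀ r ∈ Set.Icc r₀ R, 0 < r ∧ a < r ^ 2 ∧ 0 < sfun a r := by
    intro r h
    have h1 : 0 < r := hr.trans_le h.1
    have h2 : a < r ^ 2 := hra.trans_le (by gcongr; exact h.1)
    exact ⟨h1, h2, div_pos (by linarith) h1⟩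
  have hcs : ContinuousOn (fun z : ℝ × ℝ => sfun a z.2) (Set.Icc t₁ t₂ ×ˢ Set.Icc r₀ R) := by
    unfold sfun
    refine ContinuousOn.div (by fun_prop) (by fun_prop) fun z hz => (hrr _ hz.2).1.ne'
  have hcv : ContinuousOn (fun z : ℝ × ℝ => v0 a c z.1 z.2) (Set.Icc t₁ t₂ ×ˢ Set.Icc r₀ R) := by
    unfold v0
    refine ContinuousOn.div (by fun_prop) (by fun_prop) fun z hz => ?_
    have := (hrr _ hz.2).2.2
    have : 0 < z.1 := ht0.trans_le hz.1.1
    positivity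
  have hcP : ∀ k, ContinuousOn (fun z : ℝ × ℝ => Phi k m (z.2 * z.1) (v0 a c z.1 z.2)) (Set.Icc t₁ t₂ ×ˢ Set.Icc r₀ R) := by
    intro k
    exact (Phi_cont k m).comp_continuousOn (f := fun z : ℝ × ℝ => (z.2 * z.1, v0 a c z.1 z.2)) (by fun_prop)
  have hcW : ∀ k, ContinuousOn (fun z : ℝ × ℝ => Wt k (v0 a c z.1 z.2)) (Set.Icc t₁ t₂ ×ˢ Set.Icc r₀ R) :=
    fun k => (Wt_continuous k).comp_continuousOn hcv
  have hcP0 := hcP 0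
  have hcP1 := hcP 1
  have hcP2 := hcP 2
  have hcW1 := hcW (m + 1)
  have hcW3 := hcW (m + 3)
  have hbt : ContinuousOn (fun z : ℝ × ℝ => 1 / sfun a z.2 - v0 a c z.1 z.2 / z.1) (Set.Icc t₁ t₂ ×ˢ Set.Icc r₀ R) := by
    refine (ContinuousOn.div (by fun_prop) hcs fun z hz => (hrr _ hz.2).2.2.ne').sub
      (ContinuousOn.div hcv (by fun_prop) fun z hz => (ht0.trans_le hz.1.1).ne')
  have hbr : ContinuousOn (fun z : ℝ × ℝ => (1 / z.1 - v0 a c z.1 z.2 / sfun a z.2) * (1 + a / z.2 ^ 2)) (Set.Icc t₁ t₂ ×ˢ Set.Icc r₀ R) := by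
    refine ((ContinuousOn.div (by fun_prop) (by fun_prop) fun z hz => (ht0.trans_le hz.1.1).ne').sub
      (ContinuousOn.div hcv hcs fun z hz => (hrr _ hz.2).2.2.ne')).mul
      (continuousOn_const.add (ContinuousOn.div (by fun_prop) (by fun_prop) fun z hz => (pow_pos (hrr _ hz.2).1 2).ne'))
  have hqa : ∀ z ∈ (Set.Icc t₁ t₂ ×ˢ Set.Icc r₀ R : Set (ℝ × ℝ)), z.2 ^ 2 + a ≠ 0 := by
    intro z hz; positivity
  have hqa2 : ∀ z ∈ (Set.Icc t₁ t₂ ×ˢ Set.Icc r₀ R : Set (ℝ × ℝ)), (z.2 ^ 2 + a) ^ 2 ≠ 0 := by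
    intro z hz; positivity
  have hcF : ContinuousOn (fun z : ℝ × ℝ => Ffun m z.1 z.2 (v0 a c z.1 z.2)) (Set.Icc t₁ t₂ ×ˢ Set.Icc r₀ R) := by
    unfold Ffun; fun_prop
  have hcH : ContinuousOn (fun z : ℝ × ℝ => Hfun m z.1 z.2 (v0 a c z.1 z.2) - Cfun m a z.1 z.2 (v0 a c z.1 z.2)) (Set.Icc t₁ t₂ ×ˢ Set.Icc r₀ R) := by
    unfold Hfun Cfun
    have h1 : ContinuousOn (fun z : ℝ × ℝ => z.2 ^ (m + 3) / (z.2 ^ 2 + a)) (Set.Icc t₁ t₂ ×ˢ Set.Icc r₀ R) :=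
      ContinuousOn.div (by fun_prop) (by fun_prop) hqa
    fun_prop
  refine green (F := fun t r => Ffun m t r (v0 a c t r))
    (H := fun t r => Hfun m t r (v0 a c t r) - Cfun m a t r (v0 a c t r))
    (dF := fun t r => dFfun m t r (v0 a c t r) (1 / sfun a r - v0 a c t r / t))
    (dH := fun t r => dHfun m t r (v0 a c t r) ((1 / t - v0 a c t r / sfun a r) * (1 + a / r ^ 2))
      - dCfun m a t r (v0 a c t r) ((1 / t - v0 a c t r / sfun a r) * (1 + a / r ^ 2)))
    ht hR ?_ ?_ ?_ ?_ ?_ ?_ ?_ ?_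
  · unfold Function.uncurry dFfun
    fun_prop
  · unfold Function.uncurry dHfun dCfun
    have h1 : ContinuousOn (fun z : ℝ × ℝ => ((m : ℝ) + 3) / (z.2 ^ 2 + a)) (Set.Icc t₁ t₂ ×ˢ Set.Icc r₀ R) :=
      ContinuousOn.div (by fun_prop) (by fun_prop) hqa
    have h2 : ContinuousOn (fun z : ℝ × ℝ => 2 * z.2 ^ 2 / (z.2 ^ 2 + a) ^ 2) (Set.Icc t₁ t₂ ×ˢ Set.Icc r₀ R) :=
      ContinuousOn.div (by fun_prop) (by fun_prop) hqa2
    have h3 : ContinuousOn (fun z : ℝ × ℝ => z.2 * (-z.2 + z.1 * v0 a c z.1 z.2 + z.2 * z.1 * ((1 / z.1 - v0 a c z.1 z.2 / sfun a z.2) * (1 + a / z.2 ^ 2))) / (z.2 ^ 2 + a)) (Set.Icc t₁ t₂ ×ˢ Set.Icc r₀ R) :=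
      ContinuousOn.div (by fun_prop) (by fun_prop) hqa
    have h4 : ContinuousOn (fun z : ℝ × ℝ => ((m : ℝ) + 3) * z.2 * v0 a c z.1 z.2 * ((1 / z.1 - v0 a c z.1 z.2 / sfun a z.2) * (1 + a / z.2 ^ 2)) / (z.2 ^ 2 + a)) (Set.Icc t₁ t₂ ×ˢ Set.Icc r₀ R) :=
      ContinuousOn.div (by fun_prop) (by fun_prop) hqa
    fun_prop
  · intro t h r hr
    exact Ffun_deriv m (v0_deriv_t (hrr r hr).2.2.ne' (ht0.trans_le h.1).ne')
  · intro t h r hr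
    have := v0_deriv_r (c := c) (hrr r hr).1.ne' (hrr r hr).2.2.ne' (ht0.trans_le h.1).ne'
    exact (Hfun_deriv m this).sub (Cfun_deriv m ha this)
  · intro t h
    exact hcF.comp (f := fun r => (t, r)) (by fun_prop) (fun r hr => ⟨h, hr⟩)
  · exact hcH.comp (f := fun t => (t, r₀)) (by fun_prop) (fun t h => ⟨h, le_rfl, hR⟩)
  · exact hcH.comp (f := fun t => (t, R)) (by fun_prop) (fun t h => ⟨h, hR, le_rfl⟩)
  · intro t h r hr
    refine div_outer m ha (hrr r hr).1 (hrr r hr).2.1 (ht0.trans_le h.1) hc ?_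
    rcases hcond with h' | h'
    · exact Or.inl (h.2.trans h')
    · exact Or.inr h'

lemma mono_inner (m : ℕ) {t₁ t₂ r₀ : ℝ} (hr : 0 ≤ r₀) (ht : t₁ ≤ t₂) :
    (∫ r in (0 : ℝ)..r₀, Ffun m t₂ r (-1)) - (∫ r in (0 : ℝ)..r₀, Ffun m t₁ r (-1))
      ≤ - ∫ t in t₁..t₂, Hfun m t r₀ (-1) := by
  have hcP : ∀ k, Continuous (fun z : ℝ × ℝ => Phi k m (z.2 * z.1) (-1)) := by
    intro k
    exact (Phi_cont k m).comp (f := fun z : ℝ × ℝ => (z.2 * z.1, (-1 : ℝ))) (by fun_prop)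
  have hcP0 := hcP 0
  have hcP1 := hcP 1
  have hcP2 := hcP 2
  have hF : Continuous (fun z : ℝ × ℝ => Ffun m z.1 z.2 (-1)) := by unfold Ffun; fun_prop
  have hH : Continuous (fun z : ℝ × ℝ => Hfun m z.1 z.2 (-1)) := by unfold Hfun; fun_prop
  have := green (F := fun t r => Ffun m t r (-1)) (H := fun t r => Hfun m t r (-1))
    (dF := fun t r => dFfun m t r (-1) 0) (dH := fun t r => dHfun m t r (-1) 0)
    ht hr ?_ ?_ ?_ ?_ ?_ ?_ ?_ ?_
  · have h0 : ∀ t, Hfun m t 0 (-1) = 0 := by intro t; simp [Hfun]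
    simpa [h0] using this
  · unfold Function.uncurry dFfun
    fun_prop
  · unfold Function.uncurry dHfun
    fun_prop
  · intro t h r hr
    exact Ffun_deriv m (hasDerivAt_const t (-1 : ℝ))
  · intro t h r hr
    exact Hfun_deriv m (hasDerivAt_const r (-1 : ℝ))
  · intro t h
    exact (hF.comp (f := fun r => (t, r)) (by fun_prop)).continuousOn
  · exact (hH.comp (f := fun t => (t, (0 : ℝ))) (by fun_prop)).continuousOn
  · exact (hH.comp (f := fun t => (t, r₀)) (by fun_prop)).continuousOn
  · intro t h r hr
    rw [div_full, Wt_zero m (by norm_num)]; simp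


lemma lintegral_norm_polar {E : Type*} [NormedAddCommGroup E] [NormedSpace ℝ E] [MeasurableSpace E]
    [BorelSpace E] [FiniteDimensional ℝ E] [Nontrivial E] (μ : Measure E) [μ.IsAddHaarMeasure]
    {f : ℝ → ENNReal} (hf : Measurable f) :
    ∫⁻ x, f ‖x‖ ∂μ = μ.toSphere Set.univ *
      ∫⁻ y in Set.Ioi (0 : ℝ), ENNReal.ofReal (y ^ (Module.finrank ℝ E - 1)) * f y := by
  have h1 := μ.measurePreserving_homeomorphUnitSphereProd.lintegral_comp_emb
    (Homeomorph.measurableEmbedding _) (f ∘ (↑) ∘ Prod.snd)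
  simp only [Function.comp_def, homeomorphUnitSphereProd_apply_snd_coe] at h1
  have h0 : ∫⁻ x, f ‖x‖ ∂μ = ∫⁻ x in ({0}ᶜ : Set E), f ‖x‖ ∂μ := by
    rw [restrict_compl_singleton]
  rw [h0, ← lintegral_subtype_comap (by measurability), h1]
  rw [lintegral_prod _ (by fun_prop)]
  simp only [lintegral_const]
  rw [mul_comm]
  congr 1
  unfold Measure.volumeIoiPow
  rw [lintegral_withDensity_eq_lintegral_mul _ (by fun_prop) (by fun_prop),
    ← lintegral_subtype_comap measurableSet_Ioi]
  rfl

lemma S3 (m : ℕ) (x : ℝ) (h : ℝ → ENNReal) :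
    ∫⁻ ρ in Set.Ioi (0 : ℝ), ENNReal.ofReal (ρ ^ (m + 2)) * h (Real.sqrt (x ^ 2 + ρ ^ 2))
      = ∫⁻ r in Set.Ioi (0 : ℝ), ENNReal.ofReal (r * Real.sqrt (r ^ 2 - x ^ 2) ^ (m + 1)) * h r := by
  have hpos : ∀ r ∈ Set.Ioi |x|, 0 < r ^ 2 - x ^ 2 := by
    intro r hr
    have : x ^ 2 < r ^ 2 := by
      rw [sq_lt_sq]; exact lt_of_lt_of_le hr (le_abs_self r)
    linarith
  have himg : (fun r => Real.sqrt (r ^ 2 - x ^ 2)) '' Set.Ioi |x| = Set.Ioi 0 := by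
    ext ρ
    constructor
    · rintro ⟨r, hr, rfl⟩
      exact Real.sqrt_pos.2 (hpos r hr)
    · intro hρ
      have hρ' : 0 < ρ := hρ
      refine ⟨Real.sqrt (x ^ 2 + ρ ^ 2), ?_, ?_⟩
      · rw [Set.mem_Ioi, ← Real.sqrt_sq_eq_abs]
        exact Real.sqrt_lt_sqrt (sq_nonneg _) (by nlinarith)
      · simp only
        rw [Real.sq_sqrt (by positivity), add_sub_cancel_left, Real.sqrt_sq hρ'.le]
  have hcv := lintegral_image_eq_lintegral_abs_deriv_mul (s := Set.Ioi |x|)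
    (f := fun r => Real.sqrt (r ^ 2 - x ^ 2)) (f' := fun r => r / Real.sqrt (r ^ 2 - x ^ 2))
    measurableSet_Ioi (fun r hr => by
      have h1 : HasDerivAt (fun r : ℝ => r ^ 2 - x ^ 2) (2 * r) r := by
        simpa using ((hasDerivAt_id r).pow 2).sub_const (x ^ 2)
      refine ((h1.sqrt (hpos r hr).ne').congr_deriv ?_).hasDerivWithinAt
      have := (Real.sqrt_pos.2 (hpos r hr)).ne'
      field_simp) (fun r hr s hs hrs => by
      have h1 := (Real.sqrt_inj (hpos r hr).le (hpos s hs).le).1 hrs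
      have hr0 : 0 ≤ r := (abs_nonneg x).trans (le_of_lt hr)
      have hs0 : 0 ≤ s := (abs_nonneg x).trans (le_of_lt hs)
      exact (sq_eq_sq₀ hr0 hs0).1 (by linarith))
    (fun ρ => ENNReal.ofReal (ρ ^ (m + 2)) * h (Real.sqrt (x ^ 2 + ρ ^ 2)))
  rw [himg] at hcv
  rw [hcv]
  have hsub : Set.Ioi |x| ⊆ Set.Ioi (0 : ℝ) := Set.Ioi_subset_Ioi (abs_nonneg x)
  rw [← lintegral_indicator measurableSet_Ioi, ← lintegral_indicator measurableSet_Ioi]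
  refine lintegral_congr fun r => ?_
  by_cases hr : r ∈ Set.Ioi |x|
  · rw [Set.indicator_of_mem hr, Set.indicator_of_mem (hsub hr)]
    have hp := hpos r hr
    have hs := Real.sqrt_pos.2 hp
    have hr0 : 0 < r := hsub hr
    rw [← mul_assoc, ← ENNReal.ofReal_mul (abs_nonneg _), Real.sq_sqrt hp.le, abs_of_pos (div_pos hr0 hs),
      add_sub_cancel, Real.sqrt_sq hr0.le]
    congr 2
    field_simp
    ring
  · rw [Set.indicator_of_notMem hr]
    by_cases hr0 : r ∈ Set.Ioi (0 : ℝ)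
    · rw [Set.indicator_of_mem hr0]
      have : r ^ 2 - x ^ 2 ≤ 0 := by
        have : r ^ 2 ≤ x ^ 2 := by
          rw [sq_le_sq, abs_of_pos hr0]; exact not_lt.1 hr
        linarith
      rw [Real.sqrt_eq_zero_of_nonpos this]; simp
    · rw [Set.indicator_of_notMem hr0]

lemma S4 {r : ℝ} (hr : 0 < r) (k : ℝ → ENNReal) :
    ∫⁻ x, k x = ∫⁻ v, ENNReal.ofReal r * k (r * v) := by
  have := lintegral_image_eq_lintegral_abs_deriv_mul (s := Set.univ) (f := fun v => r * v)
    (f' := fun _ => r) MeasurableSet.univ (fun v _ => by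
      have h0 : HasDerivAt (fun v : ℝ => r * v) r v := by
        simpa using (hasDerivAt_id v).const_mul r
      exact h0.hasDerivWithinAt)
    (fun v _ w _ h => mul_left_cancel₀ hr.ne' h) k
  rw [Set.image_univ, (mul_left_surjective₀ hr.ne').range_eq] at this
  simpa [abs_of_pos hr] using this

lemma S5 (m : ℕ) {r : ℝ} (hr : 0 < r) (v : ℝ) :
    r * (r * Real.sqrt (r ^ 2 - (r * v) ^ 2) ^ (m + 1)) = r ^ (m + 3) * Wt (m + 1) v := by
  have : r ^ 2 - (r * v) ^ 2 = r ^ 2 * (1 - v ^ 2) := by ring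
  rw [this, Real.sqrt_mul (by positivity), Real.sqrt_sq hr.le, mul_pow]
  unfold Wt; ring

lemma reduction0 (m : ℕ) (T : ℝ) {g : ℝ × ℝ → ENNReal} (hg : Measurable g) :
    ∫⁻ x : Fin (m + 4) → ℝ, g (Real.sqrt (∑ i, x i ^ 2), T * x 0)
      = (volume : Measure (EuclideanSpace ℝ (Fin (m + 3)))).toSphere Set.univ *
        ∫⁻ r in Set.Ioi (0 : ℝ), ∫⁻ v, ENNReal.ofReal (r ^ (m + 3) * Wt (m + 1) v) * g (r, T * (r * v)) := by
  have e1 := (volume_preserving_piFinSuccAbove (fun _ : Fin (m + 4) => ℝ) 0).lintegral_comp_emb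
    (MeasurableEquiv.measurableEmbedding _)
    (fun z : ℝ × (Fin (m + 3) → ℝ) => g (Real.sqrt (z.1 ^ 2 + ∑ i, z.2 i ^ 2), T * z.1))
  have e1' : ∀ x : Fin (m + 4) → ℝ, g (Real.sqrt (∑ i, x i ^ 2), T * x 0) =
      (fun z : ℝ × (Fin (m + 3) → ℝ) => g (Real.sqrt (z.1 ^ 2 + ∑ i, z.2 i ^ 2), T * z.1))
        (MeasurableEquiv.piFinSuccAbove (fun _ : Fin (m + 4) => ℝ) 0 x) := by
    intro x
    rw [Fin.sum_univ_succ]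
    rfl
  rw [lintegral_congr e1', e1, Measure.volume_eq_prod, lintegral_prod _ (by fun_prop)]
  have e2 : ∀ x : ℝ, ∫⁻ y : Fin (m + 3) → ℝ, g (Real.sqrt (x ^ 2 + ∑ i, y i ^ 2), T * x)
      = (volume : Measure (EuclideanSpace ℝ (Fin (m + 3)))).toSphere Set.univ *
        ∫⁻ r in Set.Ioi (0 : ℝ), ENNReal.ofReal (r * Real.sqrt (r ^ 2 - x ^ 2) ^ (m + 1)) * g (r, T * x) := by
    intro x
    rw [← S3 m x (fun r => g (r, T * x))]
    have h1 := lintegral_norm_polar (volume : Measure (EuclideanSpace ℝ (Fin (m + 3))))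
      (f := fun ρ => g (Real.sqrt (x ^ 2 + ρ ^ 2), T * x)) (by fun_prop)
    simp only [finrank_euclideanSpace, Fintype.card_fin, Nat.add_succ_sub_one] at h1
    rw [← h1, ← (PiLp.volume_preserving_toLp (Fin (m + 3))).lintegral_comp (by fun_prop)]
    refine lintegral_congr fun y => ?_
    congr 3
    rw [EuclideanSpace.norm_sq_eq]; simp
  simp only
  rw [lintegral_congr e2, lintegral_const_mul _ ?_]
  · congr 1
    rw [lintegral_lintegral_swap ?_]
    · refine setLIntegral_congr_fun measurableSet_Ioi fun r hr => ?_
      have hr0 : 0 < r := hr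
      rw [S4 hr0]
      refine lintegral_congr fun v => ?_
      rw [← mul_assoc, ← ENNReal.ofReal_mul hr0.le, S5 m hr0]
    · refine Measurable.aemeasurable ?_
      unfold Function.uncurry
      fun_prop
  · refine Measurable.lintegral_prod_right' (f := fun z : ℝ × ℝ =>
      ENNReal.ofReal (z.2 * Real.sqrt (z.2 ^ 2 - z.1 ^ 2) ^ (m + 1)) * g (z.2, T * z.1)) ?_
    fun_prop

lemma reduction (m : ℕ) (θ : Fin (m + 4) → ℝ) {g : ℝ × ℝ → ENNReal} (hg : Measurable g) :
    ∫⁻ x : Fin (m + 4) → ℝ, g (Real.sqrt (∑ i, x i ^ 2), ∑ i, θ i * x i)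
      = (volume : Measure (EuclideanSpace ℝ (Fin (m + 3)))).toSphere Set.univ *
        ∫⁻ r in Set.Ioi (0 : ℝ), ∫⁻ v, ENNReal.ofReal (r ^ (m + 3) * Wt (m + 1) v)
          * g (r, Real.sqrt (∑ i, θ i ^ 2) * (r * v)) := by
  rw [← reduction0 m _ hg]
  let θE : EuclideanSpace ℝ (Fin (m + 4)) := WithLp.toLp 2 θ
  let e : EuclideanSpace ℝ (Fin (m + 4)) := ‖θE‖ • (EuclideanSpace.single (0 : Fin (m + 4)) (1 : ℝ) : EuclideanSpace ℝ (Fin (m + 4)))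
  have hn : ‖θE‖ = ‖e‖ := by simp [e, norm_smul]
  let L : EuclideanSpace ℝ (Fin (m + 4)) ≃ₗᵢ[ℝ] EuclideanSpace ℝ (Fin (m + 4)) := (Submodule.span ℝ {θE - e})ᗮ.reflection
  have hL : L θE = e := Submodule.reflection_sub hn
  have hnorm : ∀ x : Fin (m + 4) → ℝ, Real.sqrt (∑ i, x i ^ 2) = ‖(WithLp.toLp 2 x : EuclideanSpace ℝ (Fin (m + 4)))‖ := by
    intro x; rw [EuclideanSpace.norm_eq]; simp
  have hin : ∀ x : Fin (m + 4) → ℝ, ∑ i, θ i * x i = inner ℝ e (L (WithLp.toLp 2 x)) := by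
    intro x
    rw [← hL, L.inner_map_map, PiLp.inner_apply]
    simp [θE, mul_comm]
  have h1 : ∀ x : Fin (m + 4) → ℝ, g (Real.sqrt (∑ i, x i ^ 2), ∑ i, θ i * x i)
     = (fun y : EuclideanSpace ℝ (Fin (m + 4)) => g (‖L y‖, inner ℝ e (L y))) (WithLp.toLp 2 x) := by
    intro x
    simp only
    rw [hin, hnorm, L.norm_map]
  have h2 : ∀ x : Fin (m + 4) → ℝ, g (Real.sqrt (∑ i, x i ^ 2), Real.sqrt (∑ i, θ i ^ 2) * x 0)
     = (fun y : EuclideanSpace ℝ (Fin (m + 4)) => g (‖y‖, inner ℝ e y)) (WithLp.toLp 2 x) := by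
    intro x
    simp only
    rw [hnorm, hnorm]
    congr 2
    simp only [e, inner_smul_left, EuclideanSpace.inner_single_left]
    simp [θE]
  have hm : Measurable (fun y : EuclideanSpace ℝ (Fin (m + 4)) => g (‖y‖, inner ℝ e y)) := by fun_prop
  have hm2 : Measurable (fun y : EuclideanSpace ℝ (Fin (m + 4)) => g (‖L y‖, inner ℝ e (L y))) := hm.comp L.continuous.measurable
  rw [lintegral_congr h1, lintegral_congr h2,
    (PiLp.volume_preserving_toLp (Fin (m + 4))).lintegral_comp hm,
    (PiLp.volume_preserving_toLp (Fin (m + 4))).lintegral_comp hm2]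
  exact L.measurePreserving.lintegral_comp hm


/-- normalising constant of the Gaussian density -/
noncomputable def kap (p : ℕ) : ℝ := (Real.sqrt (2 * Real.pi))⁻¹ ^ p

lemma kap_nonneg (p : ℕ) : 0 ≤ kap p := by unfold kap; positivity

/-- Gaussian density -/
noncomputable def gdens (p : ℕ) (θ x : Fin p → ℝ) : ℝ :=
  kap p * Real.exp (-(∑ i, (x i - θ i) ^ 2) / 2)

lemma gdens_prod (p : ℕ) (θ x : Fin p → ℝ) :
    gdens p θ x = ∏ i, gaussianPDFReal (θ i) 1 (x i) := by
  unfold gdens gaussianPDFReal kap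
  rw [Finset.prod_mul_distrib, ← Real.exp_sum]
  congr 1
  · simp
  · congr 1
    rw [← Finset.sum_div, Finset.sum_neg_distrib]
    simp

lemma gdens_meas (p : ℕ) (θ : Fin p → ℝ) : Measurable (gdens p θ) := by
  unfold gdens
  fun_prop

lemma gaussPi_eq (p : ℕ) (θ : Fin p → ℝ) :
    gaussPi p θ = volume.withDensity (fun x => ENNReal.ofReal (gdens p θ x)) := by
  unfold gaussPi
  refine (Measure.pi_eq fun s hs => ?_)
  rw [withDensity_apply _ (MeasurableSet.univ_pi hs), volume_pi, Measure.restrict_pi_pi]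
  simp only [gdens_prod]
  have hIn : ∀ i, Integrable (gaussianPDFReal (θ i) 1) (volume.restrict (s i)) := fun i =>
    (integrable_gaussianPDFReal _ _).restrict
  rw [← ofReal_integral_eq_lintegral_ofReal (Integrable.fintype_prod (f := fun i => gaussianPDFReal (θ i) 1) hIn)
    (Filter.Eventually.of_forall fun x => Finset.prod_nonneg fun i _ => gaussianPDFReal_nonneg _ _ _)]
  rw [integral_fintype_prod_eq_prod (fun i => gaussianPDFReal (θ i) 1),
    ENNReal.ofReal_prod_of_nonneg fun i _ => integral_nonneg fun x => gaussianPDFReal_nonneg _ _ _]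
  refine Finset.prod_congr rfl fun i _ => ?_
  rw [gaussianReal_apply_eq_integral _ one_ne_zero]

instance (p : ℕ) (θ : Fin p → ℝ) : IsProbabilityMeasure (gaussPi p θ) := by
  unfold gaussPi; infer_instance

lemma euclNorm_continuous {p : ℕ} : Continuous (euclNorm : (Fin p → ℝ) → ℝ) := by
  unfold euclNorm; fun_prop

lemma jsPlus_eq {p : ℕ} (a : ℝ) (x : Fin p → ℝ) :
    jsPlus a x = (max 0 (1 - a / (euclNorm x) ^ 2)) • x := by
  unfold jsPlus
  split_ifs with h
  · simp [h]
  · rfl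

lemma jsPlus_meas {p : ℕ} (a : ℝ) : Measurable (jsPlus a : (Fin p → ℝ) → _) := by
  have : (jsPlus a : (Fin p → ℝ) → _) = fun x => (max 0 (1 - a / (euclNorm x) ^ 2)) • x :=
    funext (jsPlus_eq a)
  rw [this]
  have := (euclNorm_continuous (p := p)).measurable
  fun_prop

/-- the coverage set -/
def covSet (p : ℕ) (a c : ℝ) (θ : Fin p → ℝ) : Set (Fin p → ℝ) :=
  {x : Fin p → ℝ | euclNorm (θ - jsPlus a x) ≤ c}

lemma covSet_meas (p : ℕ) (a c : ℝ) (θ : Fin p → ℝ) : MeasurableSet (covSet p a c θ) := by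
  have h : Measurable fun x : Fin p → ℝ => euclNorm (θ - jsPlus a x) :=
    (euclNorm_continuous (p := p)).measurable.comp (measurable_const.sub (jsPlus_meas a))
  exact measurableSet_le h measurable_const

/-- upper semicontinuity of the coverage probability -/
lemma usc (p : ℕ) (a c : ℝ) (θ : ℕ → Fin p → ℝ) (θ₀ : Fin p → ℝ)
    (hθ : Filter.Tendsto θ Filter.atTop (nhds θ₀)) (L : ENNReal)
    (hL : ∀ n, L ≤ gaussPi p (θ n) (covSet p a c (θ n))) :
    L ≤ gaussPi p θ₀ (covSet p a c θ₀) := by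
  have hcomp : ∀ η, gaussPi p η (covSet p a c η)ᶜ = 1 - gaussPi p η (covSet p a c η) := fun η =>
    prob_compl_eq_one_sub (covSet_meas p a c η)
  have hIn : ∀ η, gaussPi p η (covSet p a c η)ᶜ =
      ∫⁻ x, (covSet p a c η)ᶜ.indicator (fun x => ENNReal.ofReal (gdens p η x)) x := by
    intro η
    rw [gaussPi_eq, withDensity_apply _ (covSet_meas p a c η).compl,
      lintegral_indicator (covSet_meas p a c η).compl]
  have hle : gaussPi p θ₀ (covSet p a c θ₀)ᶜ ≤ 1 - L := by
    rw [hIn]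
    calc ∫⁻ x, (covSet p a c θ₀)ᶜ.indicator (fun x => ENNReal.ofReal (gdens p θ₀ x)) x
        ≤ ∫⁻ x, Filter.liminf (fun n => (covSet p a c (θ n))ᶜ.indicator
            (fun x => ENNReal.ofReal (gdens p (θ n) x)) x) Filter.atTop := by
          refine lintegral_mono fun x => ?_
          by_cases hx : x ∈ (covSet p a c θ₀)ᶜ
          · rw [Set.indicator_of_mem hx]
            have h1 : Filter.Tendsto (fun n => euclNorm (θ n - jsPlus a x)) Filter.atTop
                (nhds (euclNorm (θ₀ - jsPlus a x))) :=
              ((euclNorm_continuous (p := p)).tendsto _).comp (hθ.sub_const _)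
            have h2 : c < euclNorm (θ₀ - jsPlus a x) := by
              simpa [covSet] using hx
            have h3 : Filter.Tendsto (fun n => ENNReal.ofReal (gdens p (θ n) x)) Filter.atTop
                (nhds (ENNReal.ofReal (gdens p θ₀ x))) := by
              have : Continuous fun η => ENNReal.ofReal (gdens p η x) := by
                unfold gdens
                exact ENNReal.continuous_ofReal.comp (by fun_prop)
              exact (this.tendsto _).comp hθ
            have h4 : ∀ᶠ n in Filter.atTop, ENNReal.ofReal (gdens p (θ n) x) =
                (covSet p a c (θ n))ᶜ.indicator (fun x => ENNReal.ofReal (gdens p (θ n) x)) x := by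
              filter_upwards [h1.eventually_const_lt h2] with n hn
              rw [Set.indicator_of_mem]
              simpa [covSet] using hn
            exact ((h3.congr' h4).liminf_eq).ge
          · rw [Set.indicator_of_notMem hx]; exact zero_le
      _ ≤ Filter.liminf (fun n => ∫⁻ x, (covSet p a c (θ n))ᶜ.indicator
            (fun x => ENNReal.ofReal (gdens p (θ n) x)) x) Filter.atTop := by
          refine lintegral_liminf_le fun n => ?_
          exact ((gdens_meas p _).ennreal_ofReal).indicator (covSet_meas p a c _).compl
      _ ≤ 1 - L := by
          refine Filter.liminf_le_of_frequently_le' (Filter.Frequently.of_forall fun n => ?_)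
          rw [← hIn, hcomp]
          exact tsub_le_tsub_left (hL n) _
  rw [hcomp] at hle
  have hL1 : L ≤ 1 := (hL 0).trans prob_le_one
  have h1 := tsub_le_tsub_left hle 1
  rwa [ENNReal.sub_sub_cancel (by simp) hL1, ENNReal.sub_sub_cancel (by simp) prob_le_one] at h1

/-- continuity from above in the radius -/
lemma cont_radius (p : ℕ) (a c : ℝ) (θ : Fin p → ℝ) (L : ENNReal)
    (hL : ∀ c', c < c' → L ≤ gaussPi p θ (covSet p a c' θ)) :
    L ≤ gaussPi p θ (covSet p a c θ) := by
  have hset : covSet p a c θ = ⋂ n : ℕ, covSet p a (c + 1 / ((n : ℝ) + 1)) θ := by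
    ext x
    simp only [covSet, Set.mem_ofPred_eq, Set.mem_iInter]
    constructor
    · intro h n
      have : 0 < 1 / ((n : ℝ) + 1) := by positivity
      linarith
    · intro h
      have := tendsto_one_div_add_atTop_nhds_zero_nat (𝕜 := ℝ)
      have h2 := (tendsto_const_nhds (x := c)).add this
      rw [add_zero] at h2
      exact ge_of_tendsto' h2 h
  have hanti : Antitone fun n : ℕ => covSet p a (c + 1 / ((n : ℝ) + 1)) θ := by
    intro i j hij x hx
    simp only [covSet, Set.mem_ofPred_eq] at hx ⊢
    refine hx.trans ?_
    gcongr
  rw [hset]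
  refine ge_of_tendsto' (tendsto_measure_iInter_atTop
    (fun n => (covSet_meas p a _ θ).nullMeasurableSet) hanti ⟨0, measure_ne_top _ _⟩) fun n => hL _ ?_
  have : 0 < 1 / ((n : ℝ) + 1) := by positivity
  linarith


/-- coverage region in terms of `(|x|, ⟨θ, x⟩)` -/
def Gset (a c t : ℝ) : Set (ℝ × ℝ) :=
  {z | t ^ 2 - 2 * max 0 (1 - a / z.1 ^ 2) * z.2 + (max 0 (1 - a / z.1 ^ 2) * z.1) ^ 2 ≤ c ^ 2}

lemma Gset_meas (a c t : ℝ) : MeasurableSet (Gset a c t) :=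
  measurableSet_le (by fun_prop) (by fun_prop)

/-- density restricted to the coverage region -/
noncomputable def gf (p : ℕ) (a c t : ℝ) : ℝ × ℝ → ENNReal :=
  (Gset a c t).indicator fun z => ENNReal.ofReal (kap p * Real.exp (-(z.1 ^ 2 - 2 * z.2 + t ^ 2) / 2))

lemma gf_meas (p : ℕ) (a c t : ℝ) : Measurable (gf p a c t) :=
  Measurable.indicator (by fun_prop) (Gset_meas a c t)

/-- inner integral -/
noncomputable def inn (m : ℕ) (a c t r : ℝ) : ENNReal :=
  ∫⁻ v, ENNReal.ofReal (r ^ (m + 3) * Wt (m + 1) v) * gf (m + 4) a c t (r, t * (r * v))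

/-- the coverage, up to a constant -/
noncomputable def cov (m : ℕ) (a c t : ℝ) : ENNReal := ∫⁻ r in Set.Ioi (0 : ℝ), inn m a c t r

lemma euclNorm_sq {p : ℕ} (x : Fin p → ℝ) : euclNorm x ^ 2 = ∑ i, x i ^ 2 :=
  Real.sq_sqrt (Finset.sum_nonneg fun _ _ => sq_nonneg _)

lemma euclNorm_nonneg {p : ℕ} (x : Fin p → ℝ) : 0 ≤ euclNorm x := Real.sqrt_nonneg _

lemma gaussPi_cov (m : ℕ) (a c : ℝ) (hc : 0 ≤ c) (θ : Fin (m + 4) → ℝ) :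
    gaussPi (m + 4) θ (covSet (m + 4) a c θ) =
      (volume : Measure (EuclideanSpace ℝ (Fin (m + 3)))).toSphere Set.univ * cov m a c (euclNorm θ) := by
  unfold cov inn
  have := reduction m θ (gf_meas (m + 4) a c (euclNorm θ))
  rw [show Real.sqrt (∑ i, θ i ^ 2) = euclNorm θ from rfl] at this
  rw [← this, gaussPi_eq, withDensity_apply _ (covSet_meas _ a c θ),
    ← lintegral_indicator (covSet_meas _ a c θ)]
  refine lintegral_congr fun x => ?_
  have hmem : x ∈ covSet (m + 4) a c θ ↔
      (Real.sqrt (∑ i, x i ^ 2), ∑ i, θ i * x i) ∈ Gset a c (euclNorm θ) := by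
    unfold covSet Gset
    simp only [Set.mem_ofPred_eq]
    rw [show Real.sqrt (∑ i, x i ^ 2) = euclNorm x from rfl, jsPlus_eq,
      ← sq_le_sq₀ (euclNorm_nonneg _) hc, euclNorm_sq, mul_pow, euclNorm_sq, euclNorm_sq]
    set M := max 0 (1 - a / ∑ i, x i ^ 2)
    have : ∑ i, (θ - M • x) i ^ 2 = ∑ i, θ i ^ 2 - 2 * M * ∑ i, θ i * x i + M ^ 2 * ∑ i, x i ^ 2 := by
      rw [Finset.mul_sum, Finset.mul_sum, ← Finset.sum_sub_distrib, ← Finset.sum_add_distrib]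
      refine Finset.sum_congr rfl fun i _ => ?_
      simp only [Pi.sub_apply, Pi.smul_apply, smul_eq_mul]
      ring
    rw [this]
  unfold gf
  by_cases hx : x ∈ covSet (m + 4) a c θ
  · rw [Set.indicator_of_mem hx, Set.indicator_of_mem (hmem.1 hx)]
    unfold gdens
    congr 4
    simp only
    rw [show Real.sqrt (∑ i, x i ^ 2) = euclNorm x from rfl, euclNorm_sq, euclNorm_sq, Finset.mul_sum,
      ← Finset.sum_sub_distrib, ← Finset.sum_add_distrib]
    congr 1
    refine Finset.sum_congr rfl fun i _ => ?_
    ring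
  · rw [Set.indicator_of_notMem hx, Set.indicator_of_notMem (fun h => hx (hmem.2 h))]

lemma Phi_one (k m : ℕ) (x : ℝ) : Phi k m x 1 = 0 := by
  unfold Phi; simp

lemma Phi_ge_one (k m : ℕ) (x : ℝ) {b : ℝ} (hb : 1 ≤ b) : Phi k m x b = 0 := by
  rw [← Phi_one k m x]
  refine Phi_clip k m x fun v hv => ?_
  rw [Set.uIcc_of_ge hb] at hv
  nlinarith [hv.1]

lemma Phi_le_neg_one (k m : ℕ) (x : ℝ) {b : ℝ} (hb : b ≤ -1) : Phi k m x b = Phi k m x (-1) := by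
  refine Phi_clip k m x fun v hv => ?_
  rw [Set.uIcc_of_le hb] at hv
  nlinarith [hv.2]

lemma Phi_zero_nonneg (m : ℕ) (x b : ℝ) : 0 ≤ Phi 0 m x b := by
  by_cases hb : 1 ≤ b
  · rw [Phi_ge_one 0 m x hb]
  · refine intervalIntegral.integral_nonneg (not_le.1 hb).le fun v _ => ?_
    have := Wt_nonneg (m + 1) v
    positivity

lemma Ffun_nonneg (m : ℕ) (t b : ℝ) {r : ℝ} (hr : 0 ≤ r) : 0 ≤ Ffun m t r b := by
  unfold Ffun
  have := Phi_zero_nonneg m (r * t) b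
  positivity

lemma inn_eval (m : ℕ) (a c t b : ℝ) {r : ℝ} (hr : 0 < r)
    (h : ∀ v : ℝ, v ^ 2 < 1 → ((r, t * (r * v)) ∈ Gset a c t ↔ b ≤ v)) :
    inn m a c t r = ENNReal.ofReal (kap (m + 4) * Ffun m t r b) := by
  have hk := kap_nonneg (m + 4)
  have hW := Wt_continuous (m + 1)
  set D : ℝ := kap (m + 4) * (r ^ (m + 3) * Real.exp (-(r ^ 2 + t ^ 2) / 2)) with hD
  have hD0 : 0 ≤ D := by positivity
  have hpt : ∀ v, ENNReal.ofReal (r ^ (m + 3) * Wt (m + 1) v) * gf (m + 4) a c t (r, t * (r * v)) =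
      (Set.Icc b 1).indicator (fun v => ENNReal.ofReal
        (D * (v ^ 0 * Wt (m + 1) v * Real.exp (r * t * v)))) v := by
    intro v
    by_cases hv : v ^ 2 < 1
    · have hv1 : v ≤ 1 := by nlinarith
      unfold gf
      by_cases hb : b ≤ v
      · rw [Set.indicator_of_mem ((h v hv).2 hb), Set.indicator_of_mem (Set.mem_Icc.2 ⟨hb, hv1⟩),
          ← ENNReal.ofReal_mul (mul_nonneg (by positivity) (Wt_nonneg _ _))]
        congr 1
        have : Real.exp (-(r ^ 2 - 2 * (t * (r * v)) + t ^ 2) / 2) =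
            Real.exp (-(r ^ 2 + t ^ 2) / 2) * Real.exp (r * t * v) := by
          rw [← Real.exp_add]; congr 1; ring
        simp only
        rw [this, hD]; ring
      · rw [Set.indicator_of_notMem (fun hh => hb ((h v hv).1 hh)),
          Set.indicator_of_notMem (fun hh => hb hh.1), mul_zero]
    · rw [Wt_zero m (not_lt.1 hv)]
      simp [Set.indicator, Wt_zero m (not_lt.1 hv)]
  unfold inn
  rw [lintegral_congr hpt, lintegral_indicator measurableSet_Icc]
  have hF : kap (m + 4) * Ffun m t r b = D * Phi 0 m (r * t) b := by
    unfold Ffun; rw [hD]; ring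
  rw [hF]
  by_cases hb : b ≤ 1
  · have hc : Continuous (fun v => D * (v ^ 0 * Wt (m + 1) v * Real.exp (r * t * v))) := by fun_prop
    rw [← ofReal_integral_eq_lintegral_ofReal (hc.continuousOn.integrableOn_compact isCompact_Icc)
      (Filter.Eventually.of_forall fun v => ?_), integral_Icc_eq_integral_Ioc,
      ← intervalIntegral.integral_of_le hb, intervalIntegral.integral_const_mul]
    · rfl
    · have := Wt_nonneg (m + 1) v
      simp only [Pi.zero_apply]
      positivity
  · rw [Set.Icc_eq_empty hb, Phi_ge_one 0 m _ (not_le.1 hb).le]; simp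

lemma lint_interval {f : ℝ → ℝ} {x y : ℝ} (hxy : x ≤ y) (hf : ContinuousOn f (Set.Icc x y))
    (hn : ∀ r ∈ Set.Icc x y, 0 ≤ f r) :
    ∫⁻ r in Set.Ioc x y, ENNReal.ofReal (f r) = ENNReal.ofReal (∫ r in x..y, f r) := by
  rw [intervalIntegral.integral_of_le hxy, ofReal_integral_eq_lintegral_ofReal]
  · exact (hf.integrableOn_compact isCompact_Icc).mono_set Set.Ioc_subset_Icc_self
  · filter_upwards [ae_restrict_mem measurableSet_Ioc] with r hr
    exact hn r (Set.Ioc_subset_Icc_self hr)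

lemma Ffun_cont (m : ℕ) (t : ℝ) {B : ℝ → ℝ} {s : Set ℝ} (hB : ContinuousOn B s) :
    ContinuousOn (fun r => Ffun m t r (B r)) s := by
  unfold Ffun
  refine ContinuousOn.mul (by fun_prop) ?_
  exact (Phi_cont 0 m).comp_continuousOn (f := fun r => (r * t, B r)) (by fun_prop)

lemma cov_eval (m : ℕ) (a c t b r₀ R : ℝ) (B : ℝ → ℝ) (hr : 0 < r₀) (hR : r₀ ≤ R)
    (hB : ContinuousOn B (Set.Icc r₀ R))
    (h1 : ∀ r ∈ Set.Ioc 0 r₀, ∀ v : ℝ, v ^ 2 < 1 → ((r, t * (r * v)) ∈ Gset a c t ↔ b ≤ v))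
    (h2 : ∀ r ∈ Set.Ioc r₀ R, ∀ v : ℝ, v ^ 2 < 1 → ((r, t * (r * v)) ∈ Gset a c t ↔ B r ≤ v))
    (h3 : ∀ r ∈ Set.Ioi R, ∀ v : ℝ, v ^ 2 < 1 → ((r, t * (r * v)) ∈ Gset a c t ↔ 1 ≤ v)) :
    cov m a c t = ENNReal.ofReal (kap (m + 4) *
      ((∫ r in (0 : ℝ)..r₀, Ffun m t r b) + ∫ r in r₀..R, Ffun m t r (B r))) := by
  have hk := kap_nonneg (m + 4)
  unfold cov
  rw [← Set.Ioc_union_Ioi_eq_Ioi (hr.le.trans hR), lintegral_union measurableSet_Ioi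
    (Set.disjoint_left.2 fun x hx hx' => absurd hx.2 (not_le.2 hx')),
    ← Set.Ioc_union_Ioc_eq_Ioc hr.le hR, lintegral_union measurableSet_Ioc
    (Set.disjoint_left.2 fun x hx hx' => absurd hx.2 (not_le.2 hx'.1))]
  have e1 : ∫⁻ r in Set.Ioc 0 r₀, inn m a c t r =
      ENNReal.ofReal (∫ r in (0 : ℝ)..r₀, kap (m + 4) * Ffun m t r b) := by
    rw [← lint_interval (f := fun r => kap (m + 4) * Ffun m t r b) hr.le (continuousOn_const.mul (Ffun_cont m t continuousOn_const))
      fun r hr => mul_nonneg hk (Ffun_nonneg m t _ hr.1)]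
    exact setLIntegral_congr_fun measurableSet_Ioc fun r hr => inn_eval m a c t b hr.1 (h1 r hr)
  have e2 : ∫⁻ r in Set.Ioc r₀ R, inn m a c t r =
      ENNReal.ofReal (∫ r in r₀..R, kap (m + 4) * Ffun m t r (B r)) := by
    rw [← lint_interval (f := fun r => kap (m + 4) * Ffun m t r (B r)) hR (continuousOn_const.mul (Ffun_cont m t hB))
      fun r hr' => mul_nonneg hk (Ffun_nonneg m t _ (hr.le.trans hr'.1))]
    exact setLIntegral_congr_fun measurableSet_Ioc fun r hr' =>
      inn_eval m a c t (B r) (hr.trans hr'.1) (h2 r hr')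
  have e3 : ∫⁻ r in Set.Ioi R, inn m a c t r = 0 := by
    rw [setLIntegral_congr_fun (g := fun _ => 0) measurableSet_Ioi]
    · simp
    · intro r hr'
      have hr0 : 0 < r := (hr.trans_le hR).trans hr'
      rw [inn_eval m a c t 1 hr0 (h3 r hr')]
      simp [Ffun, Phi_one]
  rw [e1, e2, e3, add_zero, intervalIntegral.integral_const_mul, intervalIntegral.integral_const_mul,
    ← ENNReal.ofReal_add, mul_add]
  · exact mul_nonneg hk (intervalIntegral.integral_nonneg hr.le fun r hr => Ffun_nonneg m t _ hr.1)
  · exact mul_nonneg hk (intervalIntegral.integral_nonneg hR fun r hr' =>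
      Ffun_nonneg m t _ (hr.le.trans hr'.1))

lemma Gset_mem {a c t r v : ℝ} (hr : 0 < r) : (r, t * (r * v)) ∈ Gset a c t ↔
    t ^ 2 - 2 * t * max 0 (sfun a r) * v + max 0 (sfun a r) ^ 2 ≤ c ^ 2 := by
  have hs : sfun a r = (1 - a / r ^ 2) * r := by unfold sfun; field_simp
  have : max 0 (sfun a r) = max 0 (1 - a / r ^ 2) * r := by
    rw [max_mul_of_nonneg _ _ hr.le, hs, zero_mul]
  rw [this]
  unfold Gset
  simp only [Set.mem_ofPred_eq]
  rw [show t ^ 2 - 2 * max 0 (1 - a / r ^ 2) * (t * (r * v)) =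
    t ^ 2 - 2 * t * (max 0 (1 - a / r ^ 2) * r) * v by ring]

lemma sfun_mono {a r r' : ℝ} (ha : 0 < a) (hr : 0 < r) (h : r ≤ r') : sfun a r ≤ sfun a r' := by
  have hr' := hr.trans_le h
  have e : ∀ r, 0 < r → sfun a r = r - a / r := by
    intro r hr; unfold sfun; field_simp
  rw [e r hr, e r' hr']
  have : a / r' ≤ a / r := by gcongr
  linarith

lemma sfun_pos {a r : ℝ} (hr : 0 < r) (h : a < r ^ 2) : 0 < sfun a r := by
  unfold sfun; exact div_pos (by linarith) hr

lemma exists_r0 {a ε : ℝ} (ha : 0 < a) (he : 0 < ε) : ∃ r₀, 0 < r₀ ∧ a < r₀ ^ 2 ∧ sfun a r₀ ≤ ε := by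
  have hs := Real.sqrt_pos.2 ha
  have hq := Real.sq_sqrt ha.le
  refine ⟨Real.sqrt a + ε / 2, by positivity, by nlinarith, ?_⟩
  unfold sfun
  rw [div_le_iff₀ (by positivity)]
  nlinarith

lemma exists_R {a r₀ T : ℝ} (ha : 0 < a) (hr : 0 < r₀) (hT : 0 < T) : ∃ R, r₀ ≤ R ∧ T ≤ sfun a R := by
  refine ⟨r₀ + T + a + 1, by linarith, ?_⟩
  unfold sfun
  rw [le_div_iff₀ (by positivity)]
  nlinarith [mul_pos ha hr, mul_pos ha hT, mul_pos hT hr]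

lemma Gset_mid {a c t r v : ℝ} (hr : 0 < r) (hra : a < r ^ 2) (ht : 0 < t) :
    (r, t * (r * v)) ∈ Gset a c t ↔ v0 a c t r ≤ v := by
  have hs := sfun_pos hr hra
  rw [Gset_mem hr, max_eq_right hs.le]
  unfold v0
  rw [div_le_iff₀ (by positivity)]
  constructor <;> intro h <;> linarith

lemma v0_contOn {a c t r₀ R : ℝ} (hr : 0 < r₀) (hra : a < r₀ ^ 2) (ht : 0 < t) :
    ContinuousOn (fun r => v0 a c t r) (Set.Icc r₀ R) := by
  intro r hr'
  have hr0 : 0 < r := hr.trans_le hr'.1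
  have hra' : a < r ^ 2 := by nlinarith [hr'.1]
  exact (v0_deriv_r hr0.ne' (sfun_pos hr0 hra').ne' ht.ne').continuousAt.continuousWithinAt

lemma Gset_out {a c t r v : ℝ} (hc : 0 < c) (hr : 0 < r) (ht : 0 < t)
    (hs : t + c ≤ sfun a r) (hv : v ^ 2 < 1) : (r, t * (r * v)) ∈ Gset a c t ↔ 1 ≤ v := by
  have hv1 : v < 1 := by nlinarith
  have hs0 : 0 < sfun a r := by linarith
  rw [Gset_mem hr, max_eq_right hs0.le]
  constructor
  · intro h
    have := mul_pos (mul_pos ht hs0) (sub_pos.2 hv1)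
    nlinarith
  · intro h; linarith

lemma Gset_in1 {a c t r v : ℝ} (hr : 0 < r) (ht : 0 < t) (htc : t ≤ c)
    (hs : sfun a r ≤ c - t) (hv : v ^ 2 < 1) : (r, t * (r * v)) ∈ Gset a c t ↔ -1 ≤ v := by
  have hv1 : -1 < v := by nlinarith
  rw [Gset_mem hr]
  have h1 : max 0 (sfun a r) ≤ c - t := max_le (by linarith) hs
  have h0 : 0 ≤ max 0 (sfun a r) := le_max_left _ _
  generalize max 0 (sfun a r) = σ at *
  refine ⟨fun _ => hv1.le, fun _ => ?_⟩
  have := mul_nonneg (mul_nonneg ht.le h0) (by linarith : 0 ≤ 1 + v)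
  nlinarith

lemma Gset_in2 {a c t r v : ℝ} (hc : 0 < c) (hr : 0 < r) (htc : c < t)
    (hs : sfun a r ≤ t - c) (hv : v ^ 2 < 1) : (r, t * (r * v)) ∈ Gset a c t ↔ 1 ≤ v := by
  have hv1 : v < 1 := by nlinarith
  rw [Gset_mem hr]
  have h1 : max 0 (sfun a r) ≤ t - c := max_le (by linarith) hs
  have h0 : 0 ≤ max 0 (sfun a r) := le_max_left _ _
  generalize max 0 (sfun a r) = σ at *
  refine ⟨fun h => ?_, fun h => by linarith⟩
  exfalso
  rcases h0.eq_or_lt with h00 | h00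
  · rw [← h00] at h; nlinarith
  · have := mul_pos (mul_pos (hc.trans htc) h00) (sub_pos.2 hv1)
    nlinarith

lemma v0_ge_one_out {a c t r : ℝ} (hc : 0 < c) (ht : 0 < t) (hs : t + c ≤ sfun a r) :
    1 ≤ v0 a c t r := by
  have hs0 : 0 < sfun a r := by linarith
  unfold v0
  rw [le_div_iff₀ (by positivity)]
  nlinarith

lemma v0_ge_one_in {a c t r : ℝ} (hc : 0 < c) (ht : 0 < t) (hs0 : 0 < sfun a r) (hs : sfun a r ≤ t - c) :
    1 ≤ v0 a c t r := by
  unfold v0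
  rw [le_div_iff₀ (by positivity)]
  nlinarith

lemma v0_le_neg_one {a c t r : ℝ} (ht : 0 < t) (hs0 : 0 < sfun a r) (hs : sfun a r ≤ c - t) :
    v0 a c t r ≤ -1 := by
  unfold v0
  rw [div_le_iff₀ (by positivity)]
  nlinarith

lemma HC_ge_one (m : ℕ) (a t r : ℝ) {b : ℝ} (hb : 1 ≤ b) : Hfun m t r b - Cfun m a t r b = 0 := by
  unfold Hfun Cfun
  rw [Phi_ge_one 1 m _ hb, Wt_zero (m + 2) (by nlinarith)]; simp

lemma HC_le_neg_one (m : ℕ) (a t r : ℝ) {b : ℝ} (hb : b ≤ -1) :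
    Hfun m t r b - Cfun m a t r b = Hfun m t r (-1) := by
  unfold Hfun Cfun
  rw [Phi_le_neg_one 1 m _ hb, Wt_zero (m + 2) (by nlinarith)]; simp

lemma caseA (m : ℕ) {a c t₁ t₂ : ℝ} (ha : 0 < a) (hc : 0 < c) (h1 : 0 < t₁) (h12 : t₁ ≤ t₂) (h2 : t₂ < c) :
    cov m a c t₂ ≤ cov m a c t₁ := by
  obtain ⟨r₀, hr, hra, hs⟩ := exists_r0 ha (sub_pos.2 h2)
  obtain ⟨R, hR, hsR⟩ := exists_R (T := t₂ + c) ha hr (by linarith)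
  have key : ∀ t ∈ Set.Icc t₁ t₂, cov m a c t = ENNReal.ofReal (kap (m + 4) *
      ((∫ r in (0 : ℝ)..r₀, Ffun m t r (-1)) + ∫ r in r₀..R, Ffun m t r (v0 a c t r))) := by
    intro t ht
    have ht0 : 0 < t := h1.trans_le ht.1
    refine cov_eval m a c t (-1) r₀ R (fun r => v0 a c t r) hr hR (v0_contOn hr hra ht0) ?_ ?_ ?_
    · intro r hr' v hv
      exact Gset_in1 hr'.1 ht0 (ht.2.trans h2.le)
        ((sfun_mono ha hr'.1 hr'.2).trans (by linarith [ht.2])) hv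
    · intro r hr' v _
      exact Gset_mid (hr.trans hr'.1) (by nlinarith [hr'.1]) ht0
    · intro r hr' v hv
      have hr'' : R < r := hr'
      exact Gset_out hc (by linarith) ht0
        (le_trans (by linarith [ht.2]) (sfun_mono ha (by linarith) hr''.le)) hv
  rw [key t₁ ⟨le_rfl, h12⟩, key t₂ ⟨h12, le_rfl⟩]
  refine ENNReal.ofReal_le_ofReal (mul_le_mul_of_nonneg_left ?_ (kap_nonneg _))
  have hin := mono_inner m hr.le h12
  have hout := mono_outer m ha hc hr hra hR h1 h12 (Or.inl h2.le)
  have e1 : ∫ t in t₁..t₂, (Hfun m t r₀ (v0 a c t r₀) - Cfun m a t r₀ (v0 a c t r₀)) =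
      ∫ t in t₁..t₂, Hfun m t r₀ (-1) := by
    refine intervalIntegral.integral_congr fun t ht => ?_
    rw [Set.uIcc_of_le h12] at ht
    exact HC_le_neg_one m a t r₀ (v0_le_neg_one (h1.trans_le ht.1) (sfun_pos hr hra) (by linarith [ht.2]))
  have e2 : ∫ t in t₁..t₂, (Hfun m t R (v0 a c t R) - Cfun m a t R (v0 a c t R)) =
      ∫ t in t₁..t₂, (0 : ℝ) := by
    refine intervalIntegral.integral_congr fun t ht => ?_
    rw [Set.uIcc_of_le h12] at ht
    exact HC_ge_one m a t R (v0_ge_one_out hc (h1.trans_le ht.1) (by linarith [ht.2]))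
  rw [e1, e2, intervalIntegral.integral_zero] at hout
  linarith

lemma caseB (m : ℕ) {a c t₁ t₂ : ℝ} (ha : 0 < a) (hc : 0 < c) (h1 : c < t₁) (h12 : t₁ ≤ t₂)
    (ha1 : a ≤ 1) (hac : a * c ^ 2 ≤ 1) :
    cov m a c t₂ ≤ cov m a c t₁ := by
  have h10 : 0 < t₁ := hc.trans h1
  obtain ⟨r₀, hr, hra, hs⟩ := exists_r0 ha (sub_pos.2 h1)
  obtain ⟨R, hR, hsR⟩ := exists_R (T := t₂ + c) ha hr (by linarith)
  have key : ∀ t ∈ Set.Icc t₁ t₂, cov m a c t = ENNReal.ofReal (kap (m + 4) *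
      ((∫ r in (0 : ℝ)..r₀, Ffun m t r 1) + ∫ r in r₀..R, Ffun m t r (v0 a c t r))) := by
    intro t ht
    have ht0 : 0 < t := h10.trans_le ht.1
    refine cov_eval m a c t 1 r₀ R (fun r => v0 a c t r) hr hR (v0_contOn hr hra ht0) ?_ ?_ ?_
    · intro r hr' v hv
      exact Gset_in2 hc hr'.1 (h1.trans_le ht.1)
        ((sfun_mono ha hr'.1 hr'.2).trans (by linarith [ht.1])) hv
    · intro r hr' v _
      exact Gset_mid (hr.trans hr'.1) (by nlinarith [hr'.1]) ht0
    · intro r hr' v hv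
      have hr'' : R < r := hr'
      exact Gset_out hc (by linarith) ht0
        (le_trans (by linarith [ht.2]) (sfun_mono ha (by linarith) hr''.le)) hv
  rw [key t₁ ⟨le_rfl, h12⟩, key t₂ ⟨h12, le_rfl⟩]
  refine ENNReal.ofReal_le_ofReal (mul_le_mul_of_nonneg_left ?_ (kap_nonneg _))
  have hout := mono_outer m ha hc hr hra hR h10 h12 (Or.inr ⟨ha1, hac⟩)
  have e0 : ∀ t, ∫ r in (0 : ℝ)..r₀, Ffun m t r 1 = 0 := by
    intro t; simp [Ffun, Phi_one]
  have e1 : ∫ t in t₁..t₂, (Hfun m t r₀ (v0 a c t r₀) - Cfun m a t r₀ (v0 a c t r₀)) =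
      ∫ t in t₁..t₂, (0 : ℝ) := by
    refine intervalIntegral.integral_congr fun t ht => ?_
    rw [Set.uIcc_of_le h12] at ht
    exact HC_ge_one m a t r₀ (v0_ge_one_in hc (h10.trans_le ht.1) (sfun_pos hr hra) (by linarith [ht.1]))
  have e2 : ∫ t in t₁..t₂, (Hfun m t R (v0 a c t R) - Cfun m a t R (v0 a c t R)) =
      ∫ t in t₁..t₂, (0 : ℝ) := by
    refine intervalIntegral.integral_congr fun t ht => ?_
    rw [Set.uIcc_of_le h12] at ht
    exact HC_ge_one m a t R (v0_ge_one_out hc (h10.trans_le ht.1) (by linarith [ht.2]))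
  rw [e1, e2, intervalIntegral.integral_zero] at hout
  rw [e0, e0]
  linarith

/-- the vector of norm `t` along the first axis -/
def axv (m : ℕ) (t : ℝ) : Fin (m + 4) → ℝ := fun i => if i = 0 then t else 0

lemma axv_norm (m : ℕ) {t : ℝ} (ht : 0 ≤ t) : euclNorm (axv m t) = t := by
  unfold euclNorm axv
  simp [ht]

lemma axv_cont (m : ℕ) : Continuous (axv m) := by
  unfold axv
  refine continuous_pi fun i => ?_
  by_cases h : i = 0 <;> simp [h] <;> fun_prop

/-- coverage probability as a function of `t` -/
noncomputable def cp (m : ℕ) (a c t : ℝ) : ENNReal :=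
  gaussPi (m + 4) (axv m t) (covSet (m + 4) a c (axv m t))

lemma cp_eq (m : ℕ) (a c : ℝ) (hc : 0 ≤ c) (θ : Fin (m + 4) → ℝ) :
    gaussPi (m + 4) θ (covSet (m + 4) a c θ) = cp m a c (euclNorm θ) := by
  unfold cp
  rw [gaussPi_cov m a c hc, gaussPi_cov m a c hc, axv_norm m (euclNorm_nonneg _)]

lemma cp_le (m : ℕ) {a c t₁ t₂ : ℝ} (hc : 0 ≤ c) (h1 : 0 ≤ t₁) (h2 : 0 ≤ t₂)
    (h : cov m a c t₂ ≤ cov m a c t₁) : cp m a c t₂ ≤ cp m a c t₁ := by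
  unfold cp
  rw [gaussPi_cov m a c hc, gaussPi_cov m a c hc, axv_norm m h1, axv_norm m h2]
  gcongr

/-- limit from the right -/
lemma cp_right (m : ℕ) {a c t₁ t₂ : ℝ} (h12 : t₁ < t₂)
    (h : ∀ t, t₁ < t → t ≤ t₂ → cp m a c t₂ ≤ cp m a c t) : cp m a c t₂ ≤ cp m a c t₁ := by
  have hlim : Filter.Tendsto (fun n : ℕ => t₁ + (t₂ - t₁) * (1 / ((n : ℝ) + 1))) Filter.atTop (nhds t₁) := by
    have := (tendsto_one_div_add_atTop_nhds_zero_nat (𝕜 := ℝ)).const_mul (t₂ - t₁)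
    simpa using this.const_add t₁
  refine usc (m + 4) a c (fun n : ℕ => axv m (t₁ + (t₂ - t₁) * (1 / ((n : ℝ) + 1)))) (axv m t₁)
    (((axv_cont m).tendsto _).comp hlim) _ fun n => h _ ?_ ?_
  · have : 0 < (t₂ - t₁) * (1 / ((n : ℝ) + 1)) := mul_pos (by linarith) (by positivity)
    linarith
  · have h1 : 1 / ((n : ℝ) + 1) ≤ 1 := by
      rw [div_le_one (by positivity)]
      have : (0 : ℝ) ≤ n := Nat.cast_nonneg n
      linarith
    nlinarith

lemma cp_anti (m : ℕ) {a c t₁ t₂ : ℝ} (ha : 0 < a) (hc : 0 < c) (ha1 : a ≤ 1) (hac : a * c ^ 2 ≤ 1)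
    (h1 : 0 ≤ t₁) (h12 : t₁ ≤ t₂) : cp m a c t₂ ≤ cp m a c t₁ := by
  have A1 : ∀ t₁ t₂, 0 < t₁ → t₁ ≤ t₂ → t₂ ≤ c → cp m a c t₂ ≤ cp m a c t₁ := by
    intro t₁ t₂ h1 h12 h2
    refine cont_radius (m + 4) a c (axv m t₁) _ fun c' hc' => ?_
    refine le_trans ?_ (cp_le m (hc.trans hc').le h1.le (h1.le.trans h12)
      (caseA m ha (hc.trans hc') h1 h12 (h2.trans_lt hc')))
    refine measure_mono fun x hx => ?_
    exact le_trans hx hc'.le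
  have A : ∀ t₁ t₂, 0 ≤ t₁ → t₁ ≤ t₂ → t₂ ≤ c → cp m a c t₂ ≤ cp m a c t₁ := by
    intro t₁ t₂ h1 h12 h2
    rcases h12.eq_or_lt with rfl | hlt
    · exact le_rfl
    · exact cp_right m hlt fun t ht ht' => A1 t t₂ (h1.trans_lt ht) ht' h2
  have B : ∀ t₁ t₂, c ≤ t₁ → t₁ ≤ t₂ → cp m a c t₂ ≤ cp m a c t₁ := by
    intro t₁ t₂ h1 h12
    rcases h12.eq_or_lt with rfl | hlt
    · exact le_rfl
    · exact cp_right m hlt fun t ht ht' => cp_le m hc.le (by linarith) (by linarith)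
        (caseB m ha hc (h1.trans_lt ht) ht' ha1 hac)
  rcases le_total t₂ c with h2 | h2
  · exact A _ _ h1 h12 h2
  · rcases le_total t₁ c with h3 | h3
    · exact (B c t₂ le_rfl h2).trans (A t₁ c h1 h3 le_rfl)
    · exact B _ _ h3 h12

/-- Hwang–Casella (1982): for `p ≥ 4`, there is `a₀ > 0` such that for `0 < a < a₀` the
coverage probability of the recentered positive-part set is nonincreasing in `|θ|`. -/
theorem stmt9 (p : ℕ) (hp : 4 ≤ p) (c : ℝ) (hc : 0 < c) :
    ∃ a₀ : ℝ, 0 < a₀ ∧ ∀ a : ℝ, 0 < a → a < a₀ →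
      ∀ θ₁ θ₂ : Fin p → ℝ, euclNorm θ₁ ≤ euclNorm θ₂ →
        gaussPi p θ₁ {x : Fin p → ℝ | euclNorm (θ₁ - jsPlus a x) ≤ c} ≥
          gaussPi p θ₂ {x : Fin p → ℝ | euclNorm (θ₂ - jsPlus a x) ≤ c} := by
  obtain ⟨m, rfl⟩ : ∃ m, p = m + 4 := ⟨p - 4, by omega⟩
  refine ⟨min 1 (1 / c ^ 2), lt_min one_pos (by positivity), fun a ha ha0 θ₁ θ₂ h => ?_⟩
  have ha1 : a ≤ 1 := (ha0.trans_le (min_le_left _ _)).le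
  have hac : a * c ^ 2 ≤ 1 := by
    have := (ha0.trans_le (min_le_right _ _)).le
    rwa [le_div_iff₀ (by positivity)] at this
  have key := cp_anti m ha hc ha1 hac (euclNorm_nonneg θ₁) h
  rw [← cp_eq m a c hc.le, ← cp_eq m a c hc.le] at key
  exact key
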